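/- arXiv:2403.16878 — 3 statements merged into one kernel-verified Lean document; each statement's English description precedes it below -/
import Mathlib

section
/- Let X and Y be nonnegative random variables, D > 0, k ≥ 1, and suppose that for each dyadic λ ∈ {1, 2, 4, 8, ...} there is an event E_λ such that 1_{E_λ} X ≤ 1_{E_λ} Y + D λ^k and P(Ω \ E_λ) ≤ exp(−λ²). Then there exists a constant C_k ≥ 1 depending only on k such that for all p ≥ 1, E[X^p]^{1/p} ≤ E[Y^p]^{1/p} + C_k D p^{k/2}. -/
noncomputable section
open MeasureTheory


lemma rpow_le_exp_aux (x b : ℝ) (hx : 0 ≤ x) (hb : 0 < b) :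
    x ^ b ≤ (8 * b) ^ b * Real.exp (x / 8) := by
  have h1 : x ≤ 8 * b * Real.exp (x / (8 * b)) := by
    have h := Real.add_one_le_exp (x / (8 * b))
    have h2 : x / (8 * b) ≤ Real.exp (x / (8 * b)) := by linarith
    rw [div_le_iff₀ (by positivity)] at h2
    linarith
  calc x ^ b ≤ (8 * b * Real.exp (x / (8 * b))) ^ b := Real.rpow_le_rpow hx h1 hb.le
    _ = (8 * b) ^ b * Real.exp (x / 8) := by
      rw [Real.mul_rpow (by positivity) (by positivity), ← Real.exp_mul]
      congr 2
      field_simp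

/-- The pointwise bound. -/
lemma pointwise_aux (k p z : ℝ) (hk : 1 ≤ k) (hp : 1 ≤ p) (hz : 0 ≤ z) :
    z ^ p ≤ (4 * k * p) ^ (k * p / 2) ∨
    ∃ j : ℕ, ((2 : ℝ) ^ j) ^ k < z ∧
      z ^ p ≤ (4 * k * p) ^ (k * p / 2) * Real.exp (((2 : ℝ) ^ j) ^ 2 / 2) := by
  have hkp : 1 ≤ k * p := by nlinarith
  by_cases h1 : z ≤ 1
  · left
    exact (Real.rpow_le_one hz h1 (by linarith)).trans
      (Real.one_le_rpow (by nlinarith) (by linarith))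
  right
  have hex : ∃ n : ℕ, z ≤ ((2 : ℝ) ^ n) ^ k := by
    obtain ⟨n, hn⟩ := pow_unbounded_of_one_lt z (by norm_num : (1 : ℝ) < 2)
    refine ⟨n, hn.le.trans ?_⟩
    exact Real.self_le_rpow_of_one_le (one_le_pow₀ (by norm_num)) hk
  classical
  have hs := Nat.find_spec hex
  have hm : ∀ m, m < Nat.find hex → ¬ z ≤ ((2 : ℝ) ^ m) ^ k := fun m h => Nat.find_min hex h
  generalize Nat.find hex = n at hs hm
  cases n with
  | zero => simp at hs; exact absurd hs h1
  | succ j =>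
    refine ⟨j, not_le.mp (hm j (Nat.lt_succ_self j)), ?_⟩
    have h := rpow_le_exp_aux (((2 : ℝ) ^ (j + 1)) ^ 2) (k * p / 2) (by positivity) (by linarith)
    calc z ^ p ≤ (((2 : ℝ) ^ (j + 1)) ^ k) ^ p := Real.rpow_le_rpow hz hs (by linarith)
      _ = (((2 : ℝ) ^ (j + 1)) ^ 2) ^ (k * p / 2) := by
        rw [← Real.rpow_mul (by positivity), ← Real.rpow_natCast _ 2,
          ← Real.rpow_mul (by positivity)]
        congr 1
        push_cast
        ring
      _ ≤ _ := h
      _ = _ := by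
        congr 2
        · ring
        · ring

lemma sum_aux : (∑' j : ℕ, ENNReal.ofReal (Real.exp (-(((2 : ℝ) ^ j) ^ 2 / 2)))) ≠ ⊤ := by
  have hb : ∀ j : ℕ, Real.exp (-(((2 : ℝ) ^ j) ^ 2 / 2)) ≤ 2 * (1 / 4 : ℝ) ^ j := by
    intro j
    have h := Real.add_one_le_exp (((2 : ℝ) ^ j) ^ 2 / 2)
    have h4 : ((2 : ℝ) ^ j) ^ 2 = 4 ^ j := by rw [← pow_mul, mul_comm, pow_mul]; norm_num
    rw [h4] at h ⊢
    have h0 : (0 : ℝ) < 4 ^ j := by positivity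
    rw [Real.exp_neg]
    calc (Real.exp (4 ^ j / 2))⁻¹ ≤ ((4 : ℝ) ^ j / 2)⁻¹ := by
          apply inv_anti₀ (by positivity); linarith
      _ = _ := by rw [one_div, inv_pow]; field_simp
  have hsum : Summable fun j : ℕ => 2 * (1 / 4 : ℝ) ^ j :=
    (summable_geometric_of_lt_one (by norm_num) (by norm_num)).mul_left 2
  have := hsum.of_nonneg_of_le (fun j => (Real.exp_pos _).le) hb
  exact this.tsum_ofReal_ne_top

/-- **Comparison of moments.** If nonnegative random variables `X, Y` satisfy, for each
dyadic `λ = 2^j`, `1_{E_λ} X ≤ 1_{E_λ} Y + D λ^k` on an event `E_λ` with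
`P(Ω \ E_λ) ≤ exp(−λ²)`, then there is a constant `C_k ≥ 1` depending only on `k` such
that for all `p ≥ 1`, `E[X^p]^{1/p} ≤ E[Y^p]^{1/p} + C_k D p^{k/2}`. -/
theorem moment_comparison (k : ℝ) (hk : 1 ≤ k) :
    ∃ C : ℝ, 1 ≤ C ∧
      ∀ (Ω : Type) (_ : MeasurableSpace Ω) (μ : Measure Ω), IsProbabilityMeasure μ →
      ∀ (X Y : Ω → ℝ) (D : ℝ) (E : ℕ → Set Ω),
        Measurable X → Measurable Y →
        (∀ ω, 0 ≤ X ω) → (∀ ω, 0 ≤ Y ω) → 0 < D →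
        (∀ j : ℕ, MeasurableSet (E j)) →
        (∀ j : ℕ, ∀ ω ∈ E j, X ω ≤ Y ω + D * ((2 : ℝ) ^ j) ^ k) →
        (∀ j : ℕ, μ (E j)ᶜ ≤ ENNReal.ofReal (Real.exp (-((2 : ℝ) ^ j) ^ 2))) →
        ∀ p : ℝ, 1 ≤ p →
          (∫⁻ ω, ENNReal.ofReal (X ω ^ p) ∂μ) ^ (1 / p)
            ≤ (∫⁻ ω, ENNReal.ofReal (Y ω ^ p) ∂μ) ^ (1 / p)
              + ENNReal.ofReal (C * D * p ^ (k / 2)) := by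
  set S : ENNReal := ∑' j : ℕ, ENNReal.ofReal (Real.exp (-(((2 : ℝ) ^ j) ^ 2 / 2))) with hS
  have hSt : S ≠ ⊤ := sum_aux
  set K : ℝ := 1 + S.toReal with hK
  have hK1 : 1 ≤ K := by have := ENNReal.toReal_nonneg (a := S); linarith
  have hKS : ENNReal.ofReal K = 1 + S := by
    rw [hK, ENNReal.ofReal_add (by norm_num) ENNReal.toReal_nonneg, ENNReal.ofReal_one,
      ENNReal.ofReal_toReal hSt]
  refine ⟨K * (4 * k) ^ (k / 2), ?_, ?_⟩
  · have : 1 ≤ (4 * k) ^ (k / 2) := Real.one_le_rpow (by linarith) (by linarith)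
    nlinarith
  intro Ω _ μ hμ X Y D E hX hY hX0 hY0 hD hE hXY hP p hp
  have hp0 : 0 < p := by linarith
  set Z : Ω → ℝ := fun ω => max (X ω - Y ω) 0 / D with hZ
  have hZm : Measurable Z := ((hX.sub hY).max measurable_const).div_const D
  have hZ0 : ∀ ω, 0 ≤ Z ω := fun ω => div_nonneg (le_max_right _ _) hD.le
  have hZE : ∀ j, ∀ ω ∈ E j, Z ω ≤ ((2 : ℝ) ^ j) ^ k := by
    intro j ω hω
    have h := hXY j ω hω
    rw [hZ]
    simp only
    rw [div_le_iff₀ hD]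
    apply max_le
    · linarith
    · positivity
  have hXZ : ∀ ω, X ω ≤ Y ω + D * Z ω := by
    intro ω
    have : D * Z ω = max (X ω - Y ω) 0 := by rw [hZ]; field_simp
    rw [this]
    linarith [le_max_left (X ω - Y ω) 0]
  set A : ℝ := (4 * k * p) ^ (k * p / 2) with hA
  have hA0 : 0 ≤ A := by positivity
  -- pointwise bound
  have hpt : ∀ ω, ENNReal.ofReal (Z ω ^ p) ≤ ENNReal.ofReal A *
      (1 + ∑' j : ℕ, (E j)ᶜ.indicator
        (fun _ => ENNReal.ofReal (Real.exp (((2 : ℝ) ^ j) ^ 2 / 2))) ω) := by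
    intro ω
    rcases pointwise_aux k p (Z ω) hk hp (hZ0 ω) with h | ⟨j, hj, h⟩
    · calc ENNReal.ofReal (Z ω ^ p) ≤ ENNReal.ofReal A * 1 := by
            rw [mul_one]; exact ENNReal.ofReal_le_ofReal h
        _ ≤ _ := by gcongr; exact le_self_add
    · have hω : ω ∈ (E j)ᶜ := fun hmem => absurd (hZE j ω hmem) (not_le.mpr hj)
      calc ENNReal.ofReal (Z ω ^ p)
          ≤ ENNReal.ofReal A * ENNReal.ofReal (Real.exp (((2 : ℝ) ^ j) ^ 2 / 2)) := by
            rw [← ENNReal.ofReal_mul hA0]; exact ENNReal.ofReal_le_ofReal h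
        _ ≤ _ := by
          gcongr
          refine le_trans ?_ le_add_self
          refine le_trans ?_ (ENNReal.le_tsum j)
          rw [Set.indicator_of_mem hω]
  have hint : ∫⁻ ω, ENNReal.ofReal (Z ω ^ p) ∂μ ≤ ENNReal.ofReal A * ENNReal.ofReal K := by
    refine (lintegral_mono hpt).trans ?_
    rw [lintegral_const_mul' _ _ ENNReal.ofReal_ne_top, lintegral_add_left measurable_const,
      lintegral_tsum (fun j => (measurable_const.indicator (hE j).compl).aemeasurable), hKS]
    gcongr
    · simp
    · rw [hS]
      refine ENNReal.tsum_le_tsum fun j => ?_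
      rw [lintegral_indicator_const (hE j).compl]
      refine (mul_le_mul_right (hP j) _).trans ?_
      rw [← ENNReal.ofReal_mul (Real.exp_pos _).le, ← Real.exp_add]
      apply ENNReal.ofReal_le_ofReal
      apply Real.exp_le_exp.mpr
      linarith
  have hroot : (∫⁻ ω, ENNReal.ofReal (Z ω ^ p) ∂μ) ^ (1 / p)
      ≤ ENNReal.ofReal (K * (4 * k) ^ (k / 2) * p ^ (k / 2)) := by
    refine (ENNReal.rpow_le_rpow hint (by positivity)).trans ?_
    rw [← ENNReal.ofReal_mul hA0, ENNReal.ofReal_rpow_of_nonneg (by positivity) (by positivity)]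
    apply ENNReal.ofReal_le_ofReal
    rw [Real.mul_rpow hA0 (by positivity), hA, ← Real.rpow_mul (by positivity)]
    have e : k * p / 2 * (1 / p) = k / 2 := by field_simp
    rw [e, Real.mul_rpow (by positivity) (by positivity)]
    have hKp : K ^ (1 / p) ≤ K := by
      calc K ^ (1 / p) ≤ K ^ (1 : ℝ) :=
            Real.rpow_le_rpow_of_exponent_le hK1 (by rw [div_le_one hp0]; exact hp)
        _ = K := Real.rpow_one K
    calc (4 * k) ^ (k / 2) * p ^ (k / 2) * K ^ (1 / p)
        ≤ (4 * k) ^ (k / 2) * p ^ (k / 2) * K := by gcongr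
      _ = _ := by ring
  have hmink := ENNReal.lintegral_Lp_add_le (μ := μ) (p := p)
    (f := fun ω => ENNReal.ofReal (Y ω)) (g := fun ω => ENNReal.ofReal D * ENNReal.ofReal (Z ω))
    hY.ennreal_ofReal.aemeasurable (hZm.ennreal_ofReal.const_mul _).aemeasurable hp
  calc (∫⁻ ω, ENNReal.ofReal (X ω ^ p) ∂μ) ^ (1 / p)
      ≤ (∫⁻ ω, (ENNReal.ofReal (Y ω) + ENNReal.ofReal D * ENNReal.ofReal (Z ω)) ^ p ∂μ)
          ^ (1 / p) := by
        refine ENNReal.rpow_le_rpow (lintegral_mono fun ω => ?_) (by positivity)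
        rw [← ENNReal.ofReal_rpow_of_nonneg (hX0 ω) hp0.le]
        refine ENNReal.rpow_le_rpow ?_ hp0.le
        rw [← ENNReal.ofReal_mul hD.le,
          ← ENNReal.ofReal_add (hY0 ω) (mul_nonneg hD.le (hZ0 ω))]
        exact ENNReal.ofReal_le_ofReal (hXZ ω)
    _ ≤ (∫⁻ ω, ENNReal.ofReal (Y ω) ^ p ∂μ) ^ (1 / p)
        + (∫⁻ ω, (ENNReal.ofReal D * ENNReal.ofReal (Z ω)) ^ p ∂μ) ^ (1 / p) := hmink
    _ ≤ _ := by
      apply add_le_add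
      · apply le_of_eq
        congr 2
        funext ω
        exact ENNReal.ofReal_rpow_of_nonneg (hY0 ω) hp0.le
      · have e1 : ∀ ω, (ENNReal.ofReal D * ENNReal.ofReal (Z ω)) ^ p
            = ENNReal.ofReal D ^ p * ENNReal.ofReal (Z ω ^ p) := by
          intro ω
          rw [ENNReal.mul_rpow_of_nonneg _ _ hp0.le,
            ENNReal.ofReal_rpow_of_nonneg (hZ0 ω) hp0.le]
        simp_rw [e1]
        rw [lintegral_const_mul' _ _ (ENNReal.rpow_ne_top_of_nonneg hp0.le ENNReal.ofReal_ne_top),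
          ENNReal.mul_rpow_of_nonneg _ _ (by positivity), ← ENNReal.rpow_mul,
          mul_one_div_cancel hp0.ne', ENNReal.rpow_one]
        calc _ ≤ ENNReal.ofReal D * ENNReal.ofReal (K * (4 * k) ^ (k / 2) * p ^ (k / 2)) := by
              gcongr
          _ = _ := by
            rw [← ENNReal.ofReal_mul hD.le]
            congr 1
            ring
end
end

section
/- Let α, β ∈ R, p, p₁, p₂ ∈ [1,∞] with 1/p ≥ 1/p₁ + 1/p₂, let α₁, α₂ ∈ R satisfy α ≤ min(α₁, α₂ − 1), α₁ + α₂ > 0, and α₁ + α₂ − 1 > α. Let A : T² → R² satisfy the Coulomb gauge condition ∂_j A^j = 0 and let φ : T² → C. Then the null-form estimate ‖A^j ∂_j φ‖_{B^{α,p}} ≲ ‖A‖_{B^{α₁,p₁}} ‖φ‖_{B^{α₂,p₂}} holds, where B^{s,p} = B^s_{p,∞} denotes the Besov space on T². -/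
noncomputable section
open MeasureTheory ENNReal

/-- A fundamental domain of the torus `T² = (ℝ/2πℤ)²` inside `ℝ²`. -/
def cell : Set (EuclideanSpace ℝ (Fin 2)) :=
  {x | ∀ j : Fin 2, x j ∈ Set.Ioc (0 : ℝ) (2 * Real.pi)}

/-- The `n`-th Fourier coefficient of a (`2π`-periodic) function on `T²`. -/
def fourierCoeff2 (f : EuclideanSpace ℝ (Fin 2) → ℂ) (n : Fin 2 → ℤ) : ℂ :=
  (1 / (2 * Real.pi) ^ 2 : ℂ) *
    ∫ x in cell, f x * Complex.exp (-Complex.I * ((∑ j : Fin 2, (n j : ℝ) * x j : ℝ) : ℂ))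

/-- The `k`-th Littlewood–Paley symbol built from a radial cutoff `ρ`:
`ρ(ξ)` for `k = 0` and `ρ(ξ/2^k) − ρ(ξ/2^{k−1})` for `k ≥ 1`. -/
def lpSymbol (ρ : (Fin 2 → ℝ) → ℝ) (k : ℕ) (n : Fin 2 → ℤ) : ℝ :=
  if k = 0 then ρ (fun j => (n j : ℝ))
  else ρ (fun j => (n j : ℝ) / 2 ^ k) - ρ (fun j => (n j : ℝ) / 2 ^ (k - 1))

/-- The Littlewood–Paley projection `P_{2^k} f` (a trigonometric polynomial; the symbol
vanishes outside the box `|n_j| ≤ 2^{k+1}`, so the finite sum is the full projection). -/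
def lpProj (ρ : (Fin 2 → ℝ) → ℝ) (k : ℕ) (f : EuclideanSpace ℝ (Fin 2) → ℂ) :
    EuclideanSpace ℝ (Fin 2) → ℂ :=
  fun x => ∑ n ∈ Fintype.piFinset (fun _ : Fin 2 => Finset.Icc (-(2 ^ (k + 1) : ℤ)) (2 ^ (k + 1))),
    (lpSymbol ρ k n : ℂ) * fourierCoeff2 f n *
      Complex.exp (Complex.I * ((∑ j : Fin 2, (n j : ℝ) * x j : ℝ) : ℂ))

/-- The Besov norm `‖f‖_{B^{s,p}} = sup_N N^s ‖P_N f‖_{L^p(T²)}`, `N = 2^k` dyadic. -/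
def besovNorm (ρ : (Fin 2 → ℝ) → ℝ) (s : ℝ) (p : ℝ≥0∞)
    (f : EuclideanSpace ℝ (Fin 2) → ℂ) : ℝ≥0∞ :=
  ⨆ k : ℕ, ((2 : ℝ≥0∞) ^ k) ^ s * eLpNorm (lpProj ρ k f) p (volume.restrict cell)

section

attribute [local instance] instMeasureSpaceUnitAddCircle

section

namespace NullForm

abbrev Z2 := Fin 2 → ℤ
abbrev T2 := UnitAddTorus (Fin 2)
abbrev Pol := AddMonoidAlgebra ℂ Z2

/-- The normalized Haar measure on the torus. -/
abbrev muT : Measure T2 := volume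

instance instProbT : IsProbabilityMeasure muT := by
  have : ∀ _i : Fin 2, IsProbabilityMeasure (volume : Measure UnitAddCircle) := fun _ =>
    inferInstanceAs (IsProbabilityMeasure AddCircle.haarAddCircle)
  exact inferInstanceAs (IsProbabilityMeasure (Measure.pi fun _ : Fin 2 => (volume : Measure UnitAddCircle)))

instance instHaarT : Measure.IsAddHaarMeasure muT := by
  have : ∀ _i : Fin 2, IsProbabilityMeasure (volume : Measure UnitAddCircle) := fun _ =>
    inferInstanceAs (IsProbabilityMeasure AddCircle.haarAddCircle)
  have : ∀ _i : Fin 2, Measure.IsAddHaarMeasure (volume : Measure UnitAddCircle) := fun _ =>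
    inferInstanceAs (Measure.IsAddHaarMeasure AddCircle.haarAddCircle)
  exact inferInstanceAs (Measure.IsAddHaarMeasure (Measure.pi fun _ : Fin 2 => (volume : Measure UnitAddCircle)))

/-- Fourier multiplier acting on trigonometric polynomials. -/
def ml (σ : Z2 → ℂ) : Pol →ₗ[ℂ] Pol :=
  (Finsupp.lsum ℂ (fun n => (AddMonoidAlgebra.lsingle n) ∘ₗ (LinearMap.lsmul ℂ ℂ (σ n)))) ∘ₗ
    (AddMonoidAlgebra.coeffLinearEquiv ℂ).toLinearMap

lemma ml_single (σ : Z2 → ℂ) (n : Z2) (r : ℂ) :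
    ml σ (AddMonoidAlgebra.single n r) = AddMonoidAlgebra.single n (σ n * r) := by
  simp [ml]

lemma ml_ml (σ τ : Z2 → ℂ) (x : Pol) : ml σ (ml τ x) = ml (fun n => σ n * τ n) x := by
  induction x using AddMonoidAlgebra.induction_linear with
  | zero => simp
  | add x y hx hy => simp [hx, hy]
  | single n r => simp [ml_single, mul_assoc]

lemma ml_comm (σ τ : Z2 → ℂ) (x : Pol) : ml σ (ml τ x) = ml τ (ml σ x) := by
  rw [ml_ml, ml_ml]; simp only [mul_comm]

lemma ml_smul_symb (c : ℂ) (σ : Z2 → ℂ) (x : Pol) : ml (fun n => c * σ n) x = c • ml σ x := by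
  induction x using AddMonoidAlgebra.induction_linear with
  | zero => simp
  | add x y hx hy => simp [hx, hy]
  | single n r => simp [ml_single, mul_assoc]

lemma ml_sub_symb (σ τ : Z2 → ℂ) (x : Pol) :
    ml (fun n => σ n - τ n) x = ml σ x - ml τ x := by
  induction x using AddMonoidAlgebra.induction_linear with
  | zero => simp
  | add x y hx hy => simp [hx, hy]; abel
  | single n r => simp [ml_single, sub_mul, AddMonoidAlgebra.single_sub]

lemma ml_sum_symb {ι : Type*} (s : Finset ι) (σ : ι → Z2 → ℂ) (x : Pol) :
    ml (fun n => ∑ i ∈ s, σ i n) x = ∑ i ∈ s, ml (σ i) x := by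
  induction x using AddMonoidAlgebra.induction_linear with
  | zero => simp
  | add x y hx hy => simp [hx, hy, Finset.sum_add_distrib]
  | single n r =>
    simp only [ml_single, Finset.sum_mul]
    exact map_sum (AddMonoidAlgebra.lsingle (R := ℂ) (S := ℂ) n) _ _

/-- The trigonometric polynomial as a continuous function on the torus. -/
def ev : Pol →ₐ[ℂ] C(T2, ℂ) :=
  AddMonoidAlgebra.lift ℂ C(T2, ℂ) Z2
    { toFun := fun n => UnitAddTorus.mFourier (Multiplicative.toAdd n)
      map_one' := UnitAddTorus.mFourier_zero
      map_mul' := fun m n => by ext x; exact UnitAddTorus.mFourier_add }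

lemma ev_single (n : Z2) (r : ℂ) :
    ev (AddMonoidAlgebra.single n r) = r • UnitAddTorus.mFourier n := by
  simp [ev, AddMonoidAlgebra.lift_single]

/-- Polynomial with prescribed coefficients on a finite set. -/
def cut (S : Finset Z2) (u : Z2 → ℂ) : Pol := ∑ n ∈ S, AddMonoidAlgebra.single n (u n)

lemma ml_cut (σ : Z2 → ℂ) (S : Finset Z2) (u : Z2 → ℂ) :
    ml σ (cut S u) = cut S (fun n => σ n * u n) := by
  simp [cut, ml_single]

lemma ev_single_apply (n : Z2) (r : ℂ) (t : T2) :
    ev (AddMonoidAlgebra.single n r) t = r * UnitAddTorus.mFourier n t := by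
  rw [ev_single]; rfl

lemma ev_sum_apply {ι : Type*} (s : Finset ι) (f : ι → Pol) (t : T2) :
    ev (∑ i ∈ s, f i) t = ∑ i ∈ s, ev (f i) t := by
  rw [map_sum, ContinuousMap.coe_sum, Finset.sum_apply]

lemma ev_cut (S : Finset Z2) (u : Z2 → ℂ) (t : T2) :
    ev (cut S u) t = ∑ n ∈ S, u n * UnitAddTorus.mFourier n t := by
  simp only [cut, ev_sum_apply, ev_single_apply]

lemma cut_congr {S S' : Finset Z2} {u : Z2 → ℂ} (h : ∀ n, u n ≠ 0 → n ∈ S)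
    (h' : ∀ n, u n ≠ 0 → n ∈ S') : cut S u = cut S' u := by
  have key : ∀ S : Finset Z2, (∀ n, u n ≠ 0 → n ∈ S) → cut (S ∪ S') u = cut S u := by
    intro S h
    symm
    apply Finset.sum_subset Finset.subset_union_left
    intro n _ hn
    have : u n = 0 := by by_contra hh; exact hn (h n hh)
    simp [this]
  have h2 := key S h
  have h3 : cut (S ∪ S') u = cut S' u := by
    symm
    apply Finset.sum_subset Finset.subset_union_right
    intro n _ hn
    have : u n = 0 := by by_contra hh; exact hn (h' n hh)
    simp [this]
  rw [← h2, h3]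

lemma coeff_cut (S : Finset Z2) (u : Z2 → ℂ) (h : ∀ n, u n ≠ 0 → n ∈ S) (n : Z2) :
    (cut S u).coeff n = u n := by
  classical
  have : (cut S u).coeff = ∑ n ∈ S, (AddMonoidAlgebra.single n (u n)).coeff :=
    map_sum (AddMonoidAlgebra.coeffLinearEquiv (S := ℂ) (M := Z2) ℂ) _ _
  rw [this]
  simp only [AddMonoidAlgebra.coeff_single, Finsupp.finsetSum_apply, Finsupp.single_apply,
    Finset.sum_ite_eq']
  split_ifs with hn
  · rfl
  · by_contra hh
    exact hn (h n (Ne.symm hh))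

/-- coefficients of a product -/
lemma coeff_mul_cut (x : Pol) (S : Finset Z2) (v : Z2 → ℂ) (n : Z2) :
    (x * cut S v).coeff n = ∑ m ∈ S, x.coeff (n - m) * v m := by
  rw [cut, Finset.mul_sum]
  have : (∑ i ∈ S, x * AddMonoidAlgebra.single i (v i)).coeff
      = ∑ i ∈ S, (x * AddMonoidAlgebra.single i (v i)).coeff :=
    map_sum (AddMonoidAlgebra.coeffLinearEquiv (S := ℂ) (M := Z2) ℂ) _ _
  rw [this, Finsupp.finsetSum_apply]
  refine Finset.sum_congr rfl fun m _ => ?_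
  apply AddMonoidAlgebra.coeff_mul_single_eq_coeff_mul
  intro m' _
  exact eq_sub_iff_add_eq.symm

lemma ev_ml_eq (S : Finset Z2) (σ : Z2 → ℂ) (h : ∀ n, σ n ≠ 0 → n ∈ S) (x : Pol) (t : T2) :
    ev (ml σ x) t = ∑ n ∈ S, (σ n * x.coeff n) * UnitAddTorus.mFourier n t := by
  classical
  induction x using AddMonoidAlgebra.induction_linear with
  | zero => simp
  | add x y hx hy =>
    simp only [map_add, ContinuousMap.add_apply, hx, hy, AddMonoidAlgebra.coeff_add,
      Finsupp.add_apply, mul_add, add_mul, Finset.sum_add_distrib]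
  | single n r =>
    simp only [ml_single, ev_single_apply, AddMonoidAlgebra.coeff_single]
    by_cases hn : n ∈ S
    · rw [Finset.sum_eq_single n]
      · simp
      · intro b _ hb
        simp [hb.symm]
      · exact fun h => absurd hn h
    · have : σ n = 0 := by by_contra hh; exact hn (h n hh)
      rw [this, Finset.sum_eq_zero]
      · simp
      intro b hb
      have : n ≠ b := by rintro rfl; exact hn hb
      simp [this]

/-- the derivation `∂_j` -/
def Dj (j : Fin 2) : Pol →ₗ[ℂ] Pol := ml (fun n => Complex.I * (n j : ℂ))

lemma Dj_mul (j : Fin 2) (x y : Pol) : Dj j (x * y) = Dj j x * y + x * Dj j y := by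
  induction x using AddMonoidAlgebra.induction_linear with
  | zero => simp
  | add x x' hx hx' => simp only [add_mul, map_add, hx, hx']; abel
  | single n r =>
    induction y using AddMonoidAlgebra.induction_linear with
    | zero => simp
    | add y y' hy hy' => simp only [mul_add, map_add, hy, hy']; abel
    | single m s =>
      simp only [Dj, ml_single, AddMonoidAlgebra.single_mul_single, ← AddMonoidAlgebra.single_add]
      congr 1
      push_cast [Pi.add_apply]
      ring

lemma ml_mul_zero (σ τ ω : Z2 → ℂ) (h : ∀ n m, σ (n + m) * (τ n * ω m) = 0) (x y : Pol) :
    ml σ (ml τ x * ml ω y) = 0 := by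
  induction x using AddMonoidAlgebra.induction_linear with
  | zero => simp
  | add x x' hx hx' => simp only [add_mul, map_add, hx, hx', add_zero]
  | single n r =>
    induction y using AddMonoidAlgebra.induction_linear with
    | zero => simp
    | add y y' hy hy' => simp only [mul_add, map_add, hy, hy', add_zero]
    | single m s =>
      simp only [ml_single, AddMonoidAlgebra.single_mul_single]
      rw [show σ (n + m) * (τ n * r * (ω m * s)) = (σ (n + m) * (τ n * ω m)) * (r * s) by ring, h]
      simp

end NullForm

end

section

namespace NullForm

abbrev E2 := EuclideanSpace ℝ (Fin 2)

/-- the `L^p` seminorm of a trigonometric polynomial -/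
def nm (p : ℝ≥0∞) (x : Pol) : ℝ≥0∞ := eLpNorm (ev x) p muT

lemma nm_eq_enorm (p : ℝ≥0∞) [Fact (1 ≤ p)] (x : Pol) :
    nm p x = ‖ContinuousMap.toLp (E := ℂ) p muT ℂ (ev x)‖ₑ := by
  rw [Lp.enorm_def, nm]
  exact eLpNorm_congr_ae (ContinuousMap.coeFn_toLp muT (ev x)).symm

lemma mFourier_add_arg (n : Z2) (s t : T2) :
    UnitAddTorus.mFourier n (s + t) = UnitAddTorus.mFourier n s * UnitAddTorus.mFourier n t := by
  simp only [UnitAddTorus.mFourier, ContinuousMap.coe_mk, Pi.add_apply, fourier_apply, smul_add,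
    AddCircle.toCircle_add, Circle.coe_mul, Finset.prod_mul_distrib]

lemma ev_shift (t : T2) (x : Pol) (s : T2) :
    ev (ml (fun n => UnitAddTorus.mFourier n t) x) s = ev x (s + t) := by
  induction x using AddMonoidAlgebra.induction_linear with
  | zero => simp
  | add x y hx hy => simp [hx, hy]
  | single n r =>
    simp only [ml_single, ev_single_apply, mFourier_add_arg]; ring

lemma nm_shift (p : ℝ≥0∞) (t : T2) (x : Pol) :
    nm p (ml (fun n => UnitAddTorus.mFourier n t) x) = nm p x := by
  have h : (ev (ml (fun n => UnitAddTorus.mFourier n t) x) : T2 → ℂ) = (ev x) ∘ (fun s => s + t) := by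
    funext s; exact ev_shift t x s
  rw [nm, h, eLpNorm_comp_measurePreserving (ev x).continuous.aestronglyMeasurable
    (measurePreserving_add_right muT t), nm]

/-- point of the torus `y/R` -/
def tau (R : ℝ) (y : E2) : T2 := fun j => ((-(y j) / R : ℝ) : UnitAddCircle)

lemma mFourier_coe (n : Z2) (v : Fin 2 → ℝ) :
    UnitAddTorus.mFourier n (fun j => ((v j : ℝ) : UnitAddCircle)) =
      Complex.exp (((2 * Real.pi * ∑ j, (n j : ℝ) * v j : ℝ) : ℂ) * Complex.I) := by
  simp only [UnitAddTorus.mFourier, ContinuousMap.coe_mk, fourier_coe_apply, ← Complex.exp_sum]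
  congr 1
  push_cast
  rw [Finset.mul_sum, Finset.sum_mul]
  refine Finset.sum_congr rfl fun j _ => ?_
  simp; ring

lemma mFourier_tau (R : ℝ) (n : Z2) (y : E2) : UnitAddTorus.mFourier n (tau R y) =
      Complex.exp (((2 * Real.pi * ∑ j, (n j : ℝ) * (-(y j) / R) : ℝ) : ℂ) * Complex.I) :=
  mFourier_coe n (fun j => -(y j) / R)

lemma mFourier_tau_cont (R : ℝ) (n : Z2) : Continuous fun y => UnitAddTorus.mFourier n (tau R y) := by
  simp only [mFourier_tau]
  fun_prop

lemma mult_bound (g : E2 → ℂ) (hg : HasCompactSupport g) (hg' : ContDiff ℝ (⊤ : ℕ∞) g) :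
    ∃ C : ℝ, 0 ≤ C ∧ ∀ R : ℝ, ∀ p : ℝ≥0∞, 1 ≤ p → ∀ x : Pol,
      nm p (ml (fun n => g (WithLp.toLp 2 (fun j => (n j : ℝ) / R))) x)
        ≤ ENNReal.ofReal C * nm p x := by
  set G : SchwartzMap E2 ℂ := hg.toSchwartzMap hg' with hG
  set h : SchwartzMap E2 ℂ := FourierTransform.fourierInv G with hh
  have hFG : FourierTransform.fourier h = G := by simp [hh]
  have hIntg : Integrable h := h.integrable
  have hgR : ∀ R : ℝ, ∀ n : Z2, g (WithLp.toLp 2 (fun j => (n j : ℝ) / R))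
      = ∫ y, h y * UnitAddTorus.mFourier n (tau R y) := by
    intro R n
    have h1 : g (WithLp.toLp 2 (fun j => (n j : ℝ) / R)) =
        G (WithLp.toLp 2 (fun j => (n j : ℝ) / R)) := rfl
    rw [h1, ← hFG, SchwartzMap.fourier_coe, Real.fourier_eq']
    refine integral_congr_ae (.of_forall fun y => ?_)
    simp only [mFourier_tau, smul_eq_mul]
    rw [mul_comm]
    congr 4
    simp [PiLp.inner_apply]
    ring
  refine ⟨∫ y, ‖h y‖, integral_nonneg fun _ => norm_nonneg _, ?_⟩
  intro R p hp x
  have : Fact (1 ≤ p) := ⟨hp⟩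
  simp only [hgR]
  set Q : Pol →ₗ[ℂ] Lp ℂ p muT :=
    (ContinuousMap.toLp (E := ℂ) p muT ℂ).toLinearMap ∘ₗ ev.toLinearMap with hQ
  have hi0 : ∀ n, Integrable fun y => h y * UnitAddTorus.mFourier n (tau R y) := by
    intro n
    refine hIntg.mul_bdd (c := 1) (mFourier_tau_cont R n).aestronglyMeasurable (.of_forall fun y => ?_)
    exact (ContinuousMap.norm_coe_le_norm _ _).trans UnitAddTorus.mFourier_norm.le
  have key : ∀ x : Pol, Integrable (fun y => h y • Q (ml (fun n => UnitAddTorus.mFourier n (tau R y)) x)) ∧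
      Q (ml (fun n => ∫ y, h y * UnitAddTorus.mFourier n (tau R y)) x)
        = ∫ y, h y • Q (ml (fun n => UnitAddTorus.mFourier n (tau R y)) x) := by
    intro x
    induction x using AddMonoidAlgebra.induction_linear with
    | zero => simp
    | add x y hx hy =>
      simp only [map_add, smul_add]
      refine ⟨hx.1.add hy.1, ?_⟩
      rw [integral_add hx.1 hy.1, hx.2, hy.2]
    | single n r =>
      have hs : ∀ c : ℂ, AddMonoidAlgebra.single n (c * r) = c • (AddMonoidAlgebra.single n r : Pol) := by
        intro c; simp
      simp only [ml_single, hs, map_smul, smul_smul]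
      exact ⟨(hi0 n).smul_const _, (integral_smul_const _ _).symm⟩
  have hQn : ∀ z : Pol, nm p z = ‖Q z‖ₑ := fun z => nm_eq_enorm p z
  rw [hQn, hQn, (key x).2]
  refine (enorm_integral_le_lintegral_enorm _).trans ?_
  simp only [enorm_smul, ← hQn, nm_shift]
  rw [lintegral_mul_const _ (by fun_prop), ← ofReal_integral_norm_eq_lintegral_enorm hIntg]

end NullForm

end

section

namespace NullForm

def tri (K M N : ℕ) : Prop := K ≤ max M N + 2 ∧ M ≤ max K N + 2 ∧ N ≤ max K M + 2

instance (K M N : ℕ) : Decidable (tri K M N) := by unfold tri; infer_instance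

lemma weight_exp (α α₁ α₂ δ : ℝ) (h1 : α ≤ α₁) (h2 : α ≤ α₂ - 1) (hd1 : δ ≤ α₁ + α₂)
    (hd2 : δ ≤ α₁ + α₂ - 1 - α) (K M N : ℕ) (h : tri K M N) :
    let c := 4 * |α| + 8 * |α₁| + 8 * |α₂| + 8
    let e := (K : ℝ) * α + ((min K N : ℕ) : ℝ) - M * α₁ - N * α₂
    ((M ≤ N + 2 ∧ N ≤ M + 2) ∧ e ≤ c - δ * N) ∨ ((N ≤ K + 2 ∧ K ≤ N + 2) ∧ e ≤ c - δ * M) ∨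
      ((M ≤ K + 2 ∧ K ≤ M + 2) ∧ e ≤ c - δ * N) := by
  intro c e
  obtain ⟨ha, hb, hc⟩ := h
  have hcases : (M ≤ N + 2 ∧ N ≤ M + 2 ∧ K ≤ N + 4) ∨ (N ≤ K + 2 ∧ K ≤ N + 2 ∧ M ≤ K + 4) ∨
      (M ≤ K + 2 ∧ K ≤ M + 2 ∧ N ≤ K + 4) := by omega
  have m1 : ((min K N : ℕ) : ℝ) ≤ K := by exact_mod_cast min_le_left _ _
  have m2 : ((min K N : ℕ) : ℝ) ≤ N := by exact_mod_cast min_le_right _ _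
  have hK : (0 : ℝ) ≤ K := Nat.cast_nonneg _
  have hM : (0 : ℝ) ≤ M := Nat.cast_nonneg _
  have hN : (0 : ℝ) ≤ N := Nat.cast_nonneg _
  have a0 := le_abs_self α
  have a0' := neg_abs_le α
  have a1 := le_abs_self α₁
  have a1' := neg_abs_le α₁
  have a2 := le_abs_self α₂
  have a2' := neg_abs_le α₂
  have p0 := abs_nonneg α
  have p1 := abs_nonneg α₁
  have p2 := abs_nonneg α₂
  have lin : ∀ (x y s : ℝ), x - y ≤ 2 → y - x ≤ 2 → x * s - y * s ≤ 2 * |s| := by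
    intro x y s h1 h2
    calc x * s - y * s = (x - y) * s := by ring
      _ ≤ |(x - y) * s| := le_abs_self _
      _ = |x - y| * |s| := abs_mul _ _
      _ ≤ 2 * |s| := by
        apply mul_le_mul_of_nonneg_right _ (abs_nonneg _)
        rw [abs_le]; constructor <;> linarith
  rcases hcases with ⟨q1, q2, q3⟩ | ⟨q1, q2, q3⟩ | ⟨q1, q2, q3⟩
  · left
    refine ⟨⟨q1, q2⟩, ?_⟩
    have r1 : (M : ℝ) ≤ N + 2 := by exact_mod_cast q1
    have r2 : (N : ℝ) ≤ M + 2 := by exact_mod_cast q2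
    have r3 : (K : ℝ) ≤ N + 4 := by exact_mod_cast q3
    have l := lin N M α₁ (by linarith) (by linarith)
    simp only [e, c]
    rcases le_total (α + 1) 0 with hs | hs
    · nlinarith [mul_nonneg hK (neg_nonneg.2 hs), mul_nonneg hN (sub_nonneg.2 hd1)]
    · nlinarith [mul_nonneg (sub_nonneg.2 r3) hs, mul_nonneg hN (sub_nonneg.2 hd2)]
  · right; left
    refine ⟨⟨q1, q2⟩, ?_⟩
    have r1 : (N : ℝ) ≤ K + 2 := by exact_mod_cast q1
    have r2 : (K : ℝ) ≤ N + 2 := by exact_mod_cast q2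
    have r3 : (M : ℝ) ≤ K + 4 := by exact_mod_cast q3
    have l := lin K N α₂ (by linarith) (by linarith)
    simp only [e, c]
    have hs : 0 ≤ α₂ - 1 - α := by linarith
    nlinarith [mul_nonneg (sub_nonneg.2 r3) hs, mul_nonneg hM (sub_nonneg.2 hd2)]
  · right; right
    refine ⟨⟨q1, q2⟩, ?_⟩
    have r1 : (M : ℝ) ≤ K + 2 := by exact_mod_cast q1
    have r2 : (K : ℝ) ≤ M + 2 := by exact_mod_cast q2
    have r3 : (N : ℝ) ≤ K + 4 := by exact_mod_cast q3
    have l := lin K M α₁ (by linarith) (by linarith)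
    simp only [e, c]
    have hs : 0 ≤ α₁ - α := by linarith
    nlinarith [mul_nonneg (sub_nonneg.2 r3) hs, mul_nonneg hN (sub_nonneg.2 hd2)]

lemma near_sum (s : Finset ℕ) (N : ℕ) :
    ∑ M ∈ s, (if M ≤ N + 2 ∧ N ≤ M + 2 then (1 : ℝ) else 0) ≤ 5 := by
  rw [← Finset.sum_filter, Finset.sum_const, nsmul_eq_mul, mul_one]
  have : (s.filter fun M => M ≤ N + 2 ∧ N ≤ M + 2).card ≤ (Finset.Icc (N - 2) (N + 2)).card := by
    apply Finset.card_le_card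
    intro M hM
    simp only [Finset.mem_filter, Finset.mem_Icc] at hM ⊢
    omega
  rw [Nat.card_Icc] at this
  have h2 : (s.filter fun M => M ≤ N + 2 ∧ N ≤ M + 2).card ≤ 5 := by omega
  exact_mod_cast h2

lemma weight_sum (α α₁ α₂ : ℝ) (h1 : α ≤ α₁) (h2 : α ≤ α₂ - 1) (hs1 : 0 < α₁ + α₂)
    (hs2 : α < α₁ + α₂ - 1) :
    ∃ C : ℝ, 0 < C ∧ ∀ (K : ℕ) (s : Finset ℕ), ∑ M ∈ s, ∑ N ∈ s,
      (if tri K M N then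
        (2 : ℝ) ^ ((K : ℝ) * α + ((min K N : ℕ) : ℝ) - M * α₁ - N * α₂) else 0) ≤ C := by
  set δ := min (α₁ + α₂) (α₁ + α₂ - 1 - α) with hδ
  have hδ0 : 0 < δ := lt_min hs1 (by linarith)
  set r : ℝ := (2 : ℝ) ^ (-δ) with hr
  have hr0 : 0 < r := by positivity
  have hr1 : r < 1 := Real.rpow_lt_one_of_one_lt_of_neg (by norm_num) (by linarith)
  set c := 4 * |α| + 8 * |α₁| + 8 * |α₂| + 8 with hc
  have hrn : ∀ n : ℕ, (2 : ℝ) ^ (c - δ * n) = 2 ^ c * r ^ n := by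
    intro n
    rw [sub_eq_add_neg, Real.rpow_add (by norm_num), hr, ← Real.rpow_natCast, ← Real.rpow_mul (by norm_num)]
    congr 2; ring
  have hgeo : ∀ s : Finset ℕ, ∑ n ∈ s, r ^ n ≤ (1 - r)⁻¹ := by
    intro s
    rw [← tsum_geometric_of_lt_one hr0.le hr1]
    exact (summable_geometric_of_lt_one hr0.le hr1).sum_le_tsum s (fun n _ => by positivity)
  let ind : ℕ → ℕ → ℝ := fun M N => if M ≤ N + 2 ∧ N ≤ M + 2 then (1 : ℝ) else 0
  have hind : ∀ M N, 0 ≤ ind M N := by intro M N; simp only [ind]; split_ifs <;> norm_num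
  have hpt : ∀ K M N : ℕ, (if tri K M N then
        (2 : ℝ) ^ ((K : ℝ) * α + ((min K N : ℕ) : ℝ) - M * α₁ - N * α₂) else 0) ≤
        2 ^ c * (r ^ N * ind M N) + 2 ^ c * (r ^ M * ind N K) + 2 ^ c * (r ^ N * ind M K) := by
    intro K M N
    have n1 : 0 ≤ 2 ^ c * (r ^ N * ind M N) := by have := hind M N; positivity
    have n2 : 0 ≤ 2 ^ c * (r ^ M * ind N K) := by have := hind N K; positivity
    have n3 : 0 ≤ 2 ^ c * (r ^ N * ind M K) := by have := hind M K; positivity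
    split_ifs with ht
    · have w := weight_exp α α₁ α₂ δ h1 h2 (min_le_left _ _) (min_le_right _ _) K M N ht
      simp only at w
      rcases w with ⟨q, w⟩ | ⟨q, w⟩ | ⟨q, w⟩
      · have := Real.rpow_le_rpow_of_exponent_le (x := 2) (by norm_num) w
        rw [hrn] at this
        have e1 : ind M N = 1 := if_pos q
        rw [e1] at n1 ⊢
        linarith
      · have := Real.rpow_le_rpow_of_exponent_le (x := 2) (by norm_num) w
        rw [hrn] at this
        have e1 : ind N K = 1 := if_pos q
        rw [e1] at n2 ⊢
        linarith
      · have := Real.rpow_le_rpow_of_exponent_le (x := 2) (by norm_num) w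
        rw [hrn] at this
        have e1 : ind M K = 1 := if_pos q
        rw [e1] at n3 ⊢
        linarith
    · positivity
  have h1r : 0 < 1 - r := by linarith
  refine ⟨2 ^ c * (15 * (1 - r)⁻¹), by positivity, ?_⟩
  intro K s
  have hnear : ∀ N, ∑ M ∈ s, ind M N ≤ 5 := fun N => near_sum s N
  calc _ ≤ ∑ M ∈ s, ∑ N ∈ s, (2 ^ c * (r ^ N * ind M N) + 2 ^ c * (r ^ M * ind N K)
            + 2 ^ c * (r ^ N * ind M K)) :=
        Finset.sum_le_sum fun M _ => Finset.sum_le_sum fun N _ => hpt K M N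
    _ = 2 ^ c * (∑ N ∈ s, r ^ N * ∑ M ∈ s, ind M N) + 2 ^ c * (∑ M ∈ s, r ^ M * ∑ N ∈ s, ind N K)
          + 2 ^ c * (∑ N ∈ s, r ^ N * ∑ M ∈ s, ind M K) := by
        simp only [Finset.sum_add_distrib, ← Finset.mul_sum]
        congr 2
        · rw [Finset.sum_comm]; simp only [Finset.mul_sum]
        · rw [Finset.sum_comm]; simp only [Finset.mul_sum]
    _ ≤ 2 ^ c * (∑ N ∈ s, r ^ N * 5) + 2 ^ c * (∑ M ∈ s, r ^ M * 5)
          + 2 ^ c * (∑ N ∈ s, r ^ N * 5) := by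
        gcongr <;> apply hnear
    _ ≤ _ := by
        rw [← Finset.sum_mul]
        have := hgeo s
        have h2c : (0:ℝ) < 2 ^ c := by positivity
        nlinarith [mul_le_mul_of_nonneg_left this h2c.le]

end NullForm

end

section

namespace NullForm

/-- bundled hypotheses on the cutoff which are actually used -/
structure Cutoff (ρ : (Fin 2 → ℝ) → ℝ) : Prop where
  smooth : ContDiff ℝ (⊤ : ℕ∞) ρ
  one : ∀ ξ : Fin 2 → ℝ, Real.sqrt (∑ j : Fin 2, ξ j ^ 2) ≤ 1 → ρ ξ = 1
  zero : ∀ ξ : Fin 2 → ℝ, 9 / 8 < Real.sqrt (∑ j : Fin 2, ξ j ^ 2) → ρ ξ = 0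

def nn (n : Z2) : ℝ := ‖(WithLp.toLp 2 (fun j => (n j : ℝ)) : E2)‖

lemma nn_scale (n : Z2) (k : ℕ) :
    Real.sqrt (∑ j : Fin 2, ((n j : ℝ) / 2 ^ k) ^ 2) = nn n / 2 ^ k := by
  rw [nn, EuclideanSpace.norm_eq]
  simp only [div_pow, ← Finset.sum_div, Real.norm_eq_abs, sq_abs]
  rw [Real.sqrt_div' _ (by positivity), Real.sqrt_sq (by positivity)]

lemma nn_add (n m : Z2) : nn (n + m) ≤ nn n + nn m := by
  unfold nn
  refine le_trans (le_of_eq ?_) (norm_add_le _ _)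
  congr 1
  ext j
  simp

lemma nn_neg (n : Z2) : nn (-n) = nn n := by
  unfold nn
  rw [← norm_neg]
  congr 1
  ext j
  simp

lemma abs_le_nn (n : Z2) (j : Fin 2) : |(n j : ℝ)| ≤ nn n := by
  have := PiLp.norm_apply_le (p := 2) (WithLp.toLp 2 (fun j => (n j : ℝ)) : E2) j
  simpa [nn] using this

variable {ρ : (Fin 2 → ℝ) → ℝ}

def Rk (ρ : (Fin 2 → ℝ) → ℝ) (k : ℕ) (n : Z2) : ℂ := (ρ (fun j => (n j : ℝ) / 2 ^ k) : ℂ)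

def chi (ρ : (Fin 2 → ℝ) → ℝ) (k : ℕ) (n : Z2) : ℂ := (lpSymbol ρ k n : ℂ)

lemma chi_zero (n : Z2) : chi ρ 0 n = Rk ρ 0 n := by simp [chi, Rk, lpSymbol]

lemma chi_succ (k : ℕ) (n : Z2) : chi ρ (k + 1) n = Rk ρ (k + 1) n - Rk ρ k n := by
  simp [chi, Rk, lpSymbol]

lemma sum_chi (L : ℕ) (n : Z2) : ∑ k ∈ Finset.range (L + 1), chi ρ k n = Rk ρ L n := by
  induction L with
  | zero => simp [chi_zero]
  | succ L ih => rw [Finset.sum_range_succ, ih, chi_succ]; ring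

lemma Rk_one (h : Cutoff ρ) {k : ℕ} {n : Z2} (hn : nn n ≤ 2 ^ k) : Rk ρ k n = 1 := by
  rw [Rk, h.one _ (by rw [nn_scale]; exact (div_le_one (by positivity)).2 hn)]; simp

lemma Rk_zero (h : Cutoff ρ) {k : ℕ} {n : Z2} (hn : 9 / 8 * 2 ^ k < nn n) : Rk ρ k n = 0 := by
  rw [Rk, h.zero _ (by rw [nn_scale]; exact (lt_div_iff₀ (by positivity)).2 hn)]; simp

lemma Rk_supp (h : Cutoff ρ) {k : ℕ} {n : Z2} (hn : Rk ρ k n ≠ 0) : nn n ≤ 9 / 8 * 2 ^ k := by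
  by_contra hh
  exact hn (Rk_zero h (not_le.1 hh))

lemma chi_supp (h : Cutoff ρ) {k : ℕ} {n : Z2} (hn : chi ρ k n ≠ 0) : nn n ≤ 9 / 8 * 2 ^ k := by
  cases k with
  | zero => rw [chi_zero] at hn; exact Rk_supp h hn
  | succ k =>
    by_contra hh
    push Not at hh
    apply hn
    have : (9 / 8 : ℝ) * 2 ^ k < nn n := by
      refine lt_of_le_of_lt ?_ hh
      rw [pow_succ]; have : (0:ℝ) < 2 ^ k := by positivity
      linarith
    rw [chi_succ, Rk_zero h hh, Rk_zero h this, sub_zero]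

lemma chi_supp_low (h : Cutoff ρ) {k : ℕ} {n : Z2} (hn : chi ρ k n ≠ 0) :
    k = 0 ∨ 2 ^ k < 2 * nn n := by
  cases k with
  | zero => left; rfl
  | succ k =>
    right
    by_contra hh
    push Not at hh
    apply hn
    rw [pow_succ] at hh
    have h1 : nn n ≤ 2 ^ k := by linarith
    have h2 : nn n ≤ 2 ^ (k + 1) := by
      rw [pow_succ]; have : (0:ℝ) < 2 ^ k := by positivity
      linarith
    rw [chi_succ, Rk_one h h1, Rk_one h h2, sub_self]

lemma tri_aux (h : Cutoff ρ) {K M N : ℕ} {k m n : Z2} (hk : chi ρ K k ≠ 0) (hm : chi ρ M m ≠ 0)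
    (hn : chi ρ N n ≠ 0) (hle : nn k ≤ nn m + nn n) : K ≤ max M N + 2 := by
  rcases chi_supp_low h hk with h0 | h0
  · omega
  have h1 := chi_supp h hm
  have h2 := chi_supp h hn
  have h3 : (2 : ℝ) ^ M ≤ 2 ^ (max M N) := pow_le_pow_right₀ (by norm_num) (le_max_left _ _)
  have h4 : (2 : ℝ) ^ N ≤ 2 ^ (max M N) := pow_le_pow_right₀ (by norm_num) (le_max_right _ _)
  have h5 : (2 : ℝ) ^ K < 2 ^ (max M N + 3) := by
    rw [pow_add]
    have : (0:ℝ) < 2 ^ (max M N) := by positivity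
    linarith
  have := (pow_lt_pow_iff_right₀ (by norm_num : (1:ℝ) < 2)).1 h5
  omega

lemma chi_tri (h : Cutoff ρ) {K M N : ℕ} (ht : ¬ tri K M N) (n m : Z2) :
    chi ρ K (n + m) * (chi ρ M n * chi ρ N m) = 0 := by
  by_contra hh
  have hK : chi ρ K (n + m) ≠ 0 := fun h => hh (by simp [h])
  have hM : chi ρ M n ≠ 0 := fun h => hh (by simp [h])
  have hN : chi ρ N m ≠ 0 := fun h => hh (by simp [h])
  apply ht
  refine ⟨tri_aux h hK hM hN (nn_add n m), tri_aux h hM hK hN ?_, tri_aux h hN hK hM ?_⟩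
  · have := nn_add (n + m) (-m)
    rwa [nn_neg, add_neg_cancel_right] at this
  · have := nn_add (n + m) (-n)
    rwa [nn_neg, add_comm n m, add_neg_cancel_right, add_comm m n] at this

/-! multiplier bounds -/

lemma cutoff_compact (h : Cutoff ρ) (v : E2 → ℂ) :
    HasCompactSupport fun ξ : E2 => v ξ * (ρ (WithLp.ofLp ξ) : ℂ) := by
  apply HasCompactSupport.intro (isCompact_closedBall (0 : E2) (9 / 8))
  intro ξ hξ
  have : 9 / 8 < Real.sqrt (∑ j : Fin 2, (WithLp.ofLp ξ) j ^ 2) := by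
    rw [Metric.mem_closedBall, dist_zero_right, EuclideanSpace.norm_eq] at hξ
    simpa using hξ
  rw [h.zero _ this]; simp

lemma Rk_bound (h : Cutoff ρ) : ∃ C : ℝ, 0 ≤ C ∧ ∀ (k : ℕ) (p : ℝ≥0∞), 1 ≤ p → ∀ x : Pol,
    nm p (ml (Rk ρ k) x) ≤ ENNReal.ofReal C * nm p x := by
  have hsm := h.smooth
  obtain ⟨C, hC, H⟩ := mult_bound (fun ξ : E2 => 1 * (ρ (WithLp.ofLp ξ) : ℂ)) (cutoff_compact h _)
    (contDiff_const.mul (Complex.ofRealCLM.contDiff.comp (hsm.comp (PiLp.contDiff_ofLp (p := 2)))))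
  refine ⟨C, hC, fun k p hp x => ?_⟩
  have := H (2 ^ k) p hp x
  simp only [one_mul] at this
  exact this

lemma nm_smul (p : ℝ≥0∞) (c : ℂ) (x : Pol) : nm p (c • x) = ‖c‖ₑ * nm p x := by
  rw [nm, map_smul, ContinuousMap.coe_smul, eLpNorm_const_smul, nm]

lemma nm_add (p : ℝ≥0∞) (hp : 1 ≤ p) (x y : Pol) : nm p (x + y) ≤ nm p x + nm p y := by
  rw [nm, map_add, ContinuousMap.coe_add]
  exact eLpNorm_add_le (ev x).continuous.aestronglyMeasurable
    (ev y).continuous.aestronglyMeasurable hp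

lemma nm_sub (p : ℝ≥0∞) (hp : 1 ≤ p) (x y : Pol) : nm p (x - y) ≤ nm p x + nm p y := by
  rw [nm, map_sub, ContinuousMap.coe_sub]
  exact eLpNorm_sub_le (ev x).continuous.aestronglyMeasurable
    (ev y).continuous.aestronglyMeasurable hp

lemma nm_zero (p : ℝ≥0∞) : nm p (0 : Pol) = 0 := by
  rw [nm, map_zero, ContinuousMap.coe_zero, eLpNorm_zero]

lemma nm_sum (p : ℝ≥0∞) (hp : 1 ≤ p) {ι : Type*} (s : Finset ι) (x : ι → Pol) :
    nm p (∑ i ∈ s, x i) ≤ ∑ i ∈ s, nm p (x i) := by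
  classical
  induction s using Finset.induction_on with
  | empty => simp [nm_zero]
  | insert a s ha ih =>
    rw [Finset.sum_insert ha, Finset.sum_insert ha]
    exact (nm_add p hp _ _).trans (by gcongr)

lemma nm_mul (p p₁ p₂ : ℝ≥0∞) (hpq : p₁⁻¹ + p₂⁻¹ ≤ p⁻¹) (x y : Pol) :
    nm p (x * y) ≤ nm p₁ x * nm p₂ y := by
  set r := (p₁⁻¹ + p₂⁻¹)⁻¹ with hr
  have : ENNReal.HolderTriple p₁ p₂ r := ⟨by rw [hr, inv_inv]⟩
  have hpr : p ≤ r := by rw [hr, ENNReal.le_inv_iff_le_inv]; exact hpq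
  calc nm p (x * y) ≤ nm r (x * y) :=
        eLpNorm_le_eLpNorm_of_exponent_le hpr (ev (x * y)).continuous.aestronglyMeasurable
    _ ≤ _ := by
        have := eLpNorm_smul_le_mul_eLpNorm (p := p₁) (q := p₂) (r := r) (μ := muT) (f := ev y)
          (φ := ev x) (ev y).continuous.aestronglyMeasurable (ev x).continuous.aestronglyMeasurable
        rw [nm, map_mul, ContinuousMap.coe_mul]
        exact this

lemma chi_bound (h : Cutoff ρ) : ∃ C : ℝ, 0 ≤ C ∧ ∀ (k : ℕ) (p : ℝ≥0∞), 1 ≤ p → ∀ x : Pol,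
    nm p (ml (chi ρ k) x) ≤ ENNReal.ofReal C * nm p x := by
  obtain ⟨C, hC, H⟩ := Rk_bound h
  refine ⟨C + C, by positivity, fun k p hp x => ?_⟩
  rw [ENNReal.ofReal_add hC hC, add_mul]
  cases k with
  | zero =>
    rw [show chi ρ 0 = Rk ρ 0 from funext fun n => chi_zero n]
    exact (H 0 p hp x).trans le_self_add
  | succ k =>
    rw [show chi ρ (k + 1) = fun n => Rk ρ (k + 1) n - Rk ρ k n from funext fun n => chi_succ k n,
      ml_sub_symb]
    exact (nm_sub p hp _ _).trans (add_le_add (H _ p hp x) (H _ p hp x))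

lemma DR_bound (h : Cutoff ρ) : ∃ C : ℝ, 0 ≤ C ∧ ∀ (j : Fin 2) (k : ℕ) (p : ℝ≥0∞), 1 ≤ p →
    ∀ x : Pol, nm p (Dj j (ml (Rk ρ k) x)) ≤ ENNReal.ofReal C * 2 ^ k * nm p x := by
  have hsm := h.smooth
  have key : ∀ j : Fin 2, ∃ C : ℝ, 0 ≤ C ∧ ∀ (k : ℕ) (p : ℝ≥0∞), 1 ≤ p →
    ∀ x : Pol, nm p (Dj j (ml (Rk ρ k) x)) ≤ ENNReal.ofReal C * 2 ^ k * nm p x := by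
    intro j
    obtain ⟨C, hC, H⟩ := mult_bound
      (fun ξ : E2 => (Complex.I * ((ξ j : ℝ) : ℂ)) * (ρ (WithLp.ofLp ξ) : ℂ)) (cutoff_compact h _)
      ((contDiff_const.mul (Complex.ofRealCLM.contDiff.comp
        ((contDiff_apply ℝ ℝ j).comp (PiLp.contDiff_ofLp (p := 2))))).mul
        (Complex.ofRealCLM.contDiff.comp (hsm.comp (PiLp.contDiff_ofLp (p := 2)))))
    refine ⟨C, hC, fun k p hp x => ?_⟩
    have h1 := H (2 ^ k) p hp x
    rw [Dj, ml_ml]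
    have h2 : (fun n : Z2 => Complex.I * (n j : ℂ) * Rk ρ k n) = fun n => (2 ^ k : ℂ) *
        ((Complex.I * (((n j : ℝ) / 2 ^ k : ℝ) : ℂ)) * (ρ (fun j => (n j : ℝ) / 2 ^ k) : ℂ)) := by
      funext n
      rw [Rk]; push_cast; field_simp
    rw [h2, ml_smul_symb, nm_smul]
    have h3 : ‖(2 ^ k : ℂ)‖ₑ = 2 ^ k := by
      rw [enorm_pow]; congr 1
      rw [← ofReal_norm]; simp
    rw [h3]
    calc _ ≤ 2 ^ k * (ENNReal.ofReal C * nm p x) := by gcongr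
      _ = _ := by ring
  obtain ⟨C0, hC0, H0⟩ := key 0
  obtain ⟨C1, hC1, H1⟩ := key 1
  refine ⟨C0 + C1, by positivity, fun j k p hp x => ?_⟩
  rw [ENNReal.ofReal_add hC0 hC1]
  fin_cases j
  · exact (H0 k p hp x).trans (by gcongr; exact le_self_add)
  · exact (H1 k p hp x).trans (by gcongr; exact le_add_self)

lemma chi_absorb (h : Cutoff ρ) (k : ℕ) (x : Pol) :
    ml (chi ρ k) x = ml (Rk ρ (k + 1)) (ml (chi ρ k) x) := by
  rw [ml_ml]
  congr 1
  congr 1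
  funext n
  by_cases hn : chi ρ k n = 0
  · simp [hn]
  · have := chi_supp h hn
    rw [Rk_one h, one_mul]
    rw [pow_succ]
    have : (0:ℝ) < 2 ^ k := by positivity
    linarith

/-- The basic bilinear bound for one triple of frequencies. -/
lemma bil_bound (h : Cutoff ρ) (p p₁ p₂ : ℝ≥0∞)
    (hp : 1 ≤ p) (hp₂ : 1 ≤ p₂) (hpq : p₁⁻¹ + p₂⁻¹ ≤ p⁻¹) :
    ∃ C : ℝ, 0 ≤ C ∧ ∀ (a : Fin 2 → Pol) (b : Pol), (∑ j, Dj j (a j)) = 0 → ∀ K M N : ℕ,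
      nm p (ml (chi ρ K) (∑ j, ml (chi ρ M) (a j) * Dj j (ml (chi ρ N) b))) ≤
        ENNReal.ofReal C * (2 ^ (min K N) *
          ((∑ j, nm p₁ (ml (chi ρ M) (a j))) * nm p₂ (ml (chi ρ N) b))) := by
  obtain ⟨C1, hC1, H1⟩ := chi_bound h
  obtain ⟨C2, hC2, H2⟩ := DR_bound h
  refine ⟨2 * (C1 * C2), by positivity, ?_⟩
  intro a b hab K M N
  have e2 : ENNReal.ofReal (2 * (C1 * C2)) = ENNReal.ofReal C1 * ENNReal.ofReal C2 * 2 := by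
    rw [ENNReal.ofReal_mul (by norm_num), ENNReal.ofReal_mul hC1]
    simp; ring
  rw [e2]
  rcases le_total N K with hNK | hNK
  · rw [min_eq_right hNK]
    refine (H1 K p hp _).trans ?_
    have : nm p (∑ j, ml (chi ρ M) (a j) * Dj j (ml (chi ρ N) b)) ≤
        ∑ j, nm p₁ (ml (chi ρ M) (a j)) *
          (ENNReal.ofReal C2 * 2 ^ (N + 1) * nm p₂ (ml (chi ρ N) b)) := by
      refine (nm_sum p hp _ _).trans (Finset.sum_le_sum fun j _ => ?_)
      refine (nm_mul p p₁ p₂ hpq _ _).trans ?_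
      gcongr
      conv_lhs => rw [chi_absorb h]
      exact H2 j (N + 1) p₂ hp₂ _
    rw [← Finset.sum_mul] at this
    calc _ ≤ _ := mul_le_mul_right this _
      _ = _ := by rw [pow_succ]; ring
  · rw [min_eq_left hNK]
    have e1 : ∑ j, ml (chi ρ M) (a j) * Dj j (ml (chi ρ N) b)
        = ∑ j, Dj j (ml (chi ρ M) (a j) * ml (chi ρ N) b) := by
      simp only [Dj_mul, Finset.sum_add_distrib]
      rw [← Finset.sum_mul]
      have : ∑ j, Dj j (ml (chi ρ M) (a j)) = 0 := by
        have e : ∀ j, Dj j (ml (chi ρ M) (a j)) = ml (chi ρ M) (Dj j (a j)) := fun j => ml_comm _ _ _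
        simp only [e]
        rw [← map_sum, hab, map_zero]
      rw [this, zero_mul, zero_add]
    rw [e1, map_sum]
    have : ∀ j, nm p (ml (chi ρ K) (Dj j (ml (chi ρ M) (a j) * ml (chi ρ N) b))) ≤
        ENNReal.ofReal C2 * 2 ^ (K + 1) * (ENNReal.ofReal C1 *
          (nm p₁ (ml (chi ρ M) (a j)) * nm p₂ (ml (chi ρ N) b))) := by
      intro j
      rw [Dj, ml_comm, ← Dj, chi_absorb h]
      refine (H2 j (K + 1) p hp _).trans ?_
      gcongr
      refine (H1 K p hp _).trans ?_
      gcongr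
      exact nm_mul p p₁ p₂ hpq _ _
    refine (nm_sum p hp _ _).trans ((Finset.sum_le_sum fun j _ => this j).trans (le_of_eq ?_))
    rw [← Finset.mul_sum, ← Finset.mul_sum, ← Finset.sum_mul, pow_succ]
    ring

end NullForm

end

section

namespace NullForm
variable {ρ : (Fin 2 → ℝ) → ℝ}

lemma two_pow_rpow (k : ℕ) (s : ℝ) :
    ((2 : ℝ≥0∞) ^ k) ^ s = ENNReal.ofReal ((2 : ℝ) ^ ((k : ℝ) * s)) := by
  rw [Real.rpow_mul (by norm_num), Real.rpow_natCast,
    ← ENNReal.ofReal_rpow_of_pos (by positivity), ENNReal.ofReal_pow (by norm_num)]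
  simp

lemma le_of_weight (k : ℕ) (s : ℝ) (x y : ℝ≥0∞) (h : ((2 : ℝ≥0∞) ^ k) ^ s * x ≤ y) :
    x ≤ ENNReal.ofReal ((2 : ℝ) ^ (-((k : ℝ) * s))) * y := by
  rw [two_pow_rpow] at h
  calc x = ENNReal.ofReal ((2 : ℝ) ^ (-((k : ℝ) * s))) *
          (ENNReal.ofReal ((2 : ℝ) ^ ((k : ℝ) * s)) * x) := by
        rw [← mul_assoc, ← ENNReal.ofReal_mul (by positivity), ← Real.rpow_add (by norm_num)]
        simp
    _ ≤ _ := by gcongr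

lemma fin_bound (h : Cutoff ρ) (α α₁ α₂ : ℝ) (p p₁ p₂ : ℝ≥0∞)
    (hp : 1 ≤ p) (hp₂ : 1 ≤ p₂) (hpq : p₁⁻¹ + p₂⁻¹ ≤ p⁻¹)
    (h1 : α ≤ α₁) (h2 : α ≤ α₂ - 1) (hs1 : 0 < α₁ + α₂) (hs2 : α < α₁ + α₂ - 1) :
    ∃ C : ℝ, 0 ≤ C ∧ ∀ (a : Fin 2 → Pol) (b : Pol) (L : ℕ), (∑ j, Dj j (a j)) = 0 →
      (∀ j, a j = ∑ M ∈ Finset.range L, ml (chi ρ M) (a j)) →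
      (b = ∑ M ∈ Finset.range L, ml (chi ρ M) b) →
      ∀ Aa Bb : ℝ≥0∞,
      (∀ j M, ((2 : ℝ≥0∞) ^ M) ^ α₁ * nm p₁ (ml (chi ρ M) (a j)) ≤ Aa) →
      (∀ N, ((2 : ℝ≥0∞) ^ N) ^ α₂ * nm p₂ (ml (chi ρ N) b) ≤ Bb) →
      ∀ K, ((2 : ℝ≥0∞) ^ K) ^ α * nm p (ml (chi ρ K) (∑ j, a j * Dj j b)) ≤
        ENNReal.ofReal C * (Aa * Bb) := by
  obtain ⟨C1, hC1, H1⟩ := bil_bound h p p₁ p₂ hp hp₂ hpq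
  obtain ⟨C2, hC2, H2⟩ := weight_sum α α₁ α₂ h1 h2 hs1 hs2
  refine ⟨2 * C1 * C2, by positivity, ?_⟩
  intro a b L hdiv ha hb Aa Bb hA hB K
  set s := Finset.range L with hs
  have e1 : ml (chi ρ K) (∑ j, a j * Dj j b) = ∑ M ∈ s, ∑ N ∈ s,
      ml (chi ρ K) (∑ j, ml (chi ρ M) (a j) * Dj j (ml (chi ρ N) b)) := by
    simp only [← map_sum]
    congr 1
    have : ∀ j, a j * Dj j b = ∑ M ∈ s, ∑ N ∈ s, ml (chi ρ M) (a j) * Dj j (ml (chi ρ N) b) := by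
      intro j
      conv_lhs => rw [ha j, hb]
      rw [map_sum, Finset.sum_mul_sum]
    rw [Finset.sum_congr rfl fun j _ => this j, Finset.sum_comm]
    refine Finset.sum_congr rfl fun M _ => ?_
    rw [Finset.sum_comm]
  have e2 : ∀ M N, ((2 : ℝ≥0∞) ^ K) ^ α *
      nm p (ml (chi ρ K) (∑ j, ml (chi ρ M) (a j) * Dj j (ml (chi ρ N) b))) ≤
      ENNReal.ofReal (if tri K M N then
        (2 : ℝ) ^ ((K : ℝ) * α + ((min K N : ℕ) : ℝ) - M * α₁ - N * α₂) else 0) *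
        (ENNReal.ofReal (2 * C1) * (Aa * Bb)) := by
    intro M N
    split_ifs with ht
    · have hb' := le_of_weight N α₂ _ _ (hB N)
      have ha' : (∑ j, nm p₁ (ml (chi ρ M) (a j))) ≤
          2 * (ENNReal.ofReal ((2 : ℝ) ^ (-((M : ℝ) * α₁))) * Aa) := by
        rw [Fin.sum_univ_two, two_mul]
        exact add_le_add (le_of_weight M α₁ _ _ (hA 0 M)) (le_of_weight M α₁ _ _ (hA 1 M))
      have hm : (2 : ℝ≥0∞) ^ (min K N) = ENNReal.ofReal ((2 : ℝ) ^ ((min K N : ℕ) : ℝ)) := by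
        have := two_pow_rpow (min K N) 1
        simpa using this
      calc _ ≤ ((2 : ℝ≥0∞) ^ K) ^ α * (ENNReal.ofReal C1 * (2 ^ (min K N) *
          ((2 * (ENNReal.ofReal ((2 : ℝ) ^ (-((M : ℝ) * α₁))) * Aa)) *
            (ENNReal.ofReal ((2 : ℝ) ^ (-((N : ℝ) * α₂))) * Bb)))) := by
            gcongr
            refine (H1 a b hdiv K M N).trans ?_
            gcongr
        _ = _ := by
          rw [two_pow_rpow, hm, show (K : ℝ) * α + ((min K N : ℕ) : ℝ) - M * α₁ - N * α₂ =
            (K : ℝ) * α + ((min K N : ℕ) : ℝ) + -(M * α₁) + -(N * α₂) by ring,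
            Real.rpow_add (by norm_num), Real.rpow_add (by norm_num), Real.rpow_add (by norm_num),
            ENNReal.ofReal_mul (by positivity), ENNReal.ofReal_mul (by positivity),
            ENNReal.ofReal_mul (by positivity), ENNReal.ofReal_mul (by positivity)]
          simp only [ENNReal.ofReal_ofNat]
          ring
    · have : ∀ j, ml (chi ρ K) (ml (chi ρ M) (a j) * Dj j (ml (chi ρ N) b)) = 0 := by
        intro j
        rw [Dj, ml_comm]
        exact ml_mul_zero _ _ _ (chi_tri h ht) _ _
      rw [map_sum, Finset.sum_eq_zero fun j _ => this j, nm_zero]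
      simp
  rw [e1]
  calc _ ≤ ((2 : ℝ≥0∞) ^ K) ^ α * ∑ M ∈ s, ∑ N ∈ s,
        nm p (ml (chi ρ K) (∑ j, ml (chi ρ M) (a j) * Dj j (ml (chi ρ N) b))) := by
        gcongr
        exact (nm_sum p hp _ _).trans (Finset.sum_le_sum fun M _ => nm_sum p hp _ _)
    _ ≤ ∑ M ∈ s, ∑ N ∈ s, ENNReal.ofReal (if tri K M N then
        (2 : ℝ) ^ ((K : ℝ) * α + ((min K N : ℕ) : ℝ) - M * α₁ - N * α₂) else 0) *
        (ENNReal.ofReal (2 * C1) * (Aa * Bb)) := by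
        simp only [Finset.mul_sum]
        exact Finset.sum_le_sum fun M _ => Finset.sum_le_sum fun N _ => e2 M N
    _ = ENNReal.ofReal (∑ M ∈ s, ∑ N ∈ s, (if tri K M N then
        (2 : ℝ) ^ ((K : ℝ) * α + ((min K N : ℕ) : ℝ) - M * α₁ - N * α₂) else 0)) *
        (ENNReal.ofReal (2 * C1) * (Aa * Bb)) := by
        have hnn : ∀ M N : ℕ, 0 ≤ (if tri K M N then
          (2 : ℝ) ^ ((K : ℝ) * α + ((min K N : ℕ) : ℝ) - M * α₁ - N * α₂) else 0) := by
          intro M N; split_ifs <;> positivity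
        rw [ENNReal.ofReal_sum_of_nonneg fun M _ => Finset.sum_nonneg fun N _ => hnn M N,
          Finset.sum_mul]
        refine Finset.sum_congr rfl fun M _ => ?_
        rw [ENNReal.ofReal_sum_of_nonneg fun N _ => hnn M N, Finset.sum_mul]
    _ ≤ ENNReal.ofReal C2 * (ENNReal.ofReal (2 * C1) * (Aa * Bb)) := by
        gcongr
        exact H2 K s
    _ = _ := by
        rw [ENNReal.ofReal_mul (by positivity : 0 ≤ 2 * C1)]; ring

end NullForm

end

section

namespace NullForm

/-- representative in the unit box -/
def sec0 (θ : T2) : Fin 2 → ℝ := (UnitAddTorus.measurableEquivPiIoc (fun _ : Fin 2 => (0:ℝ)) θ).1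

lemma sec0_coe (θ : T2) (j : Fin 2) : ((sec0 θ j : ℝ) : UnitAddCircle) = θ j :=
  (AddCircle.equivIoc 1 0).symm_apply_apply (θ j)

/-- representative in the cell -/
def sec (θ : T2) : E2 := (2 * Real.pi) • (WithLp.toLp 2 (sec0 θ) : E2)

lemma sec_apply (θ : T2) (j : Fin 2) : sec θ j = 2 * Real.pi * sec0 θ j := rfl

lemma mFourier_sec (n : Z2) (θ : T2) : UnitAddTorus.mFourier n θ =
    Complex.exp (Complex.I * ((∑ j : Fin 2, (n j : ℝ) * sec θ j : ℝ) : ℂ)) := by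
  have h := mFourier_coe n (sec0 θ)
  simp only [sec0_coe] at h
  rw [h]
  congr 1
  simp only [sec_apply, Fin.sum_univ_two]
  push_cast
  ring

lemma cell_meas : MeasurableSet cell := by
  have : cell = ⋂ j : Fin 2, (fun x : E2 => x j) ⁻¹' Set.Ioc (0 : ℝ) (2 * Real.pi) := by
    ext x; simp [cell]
  rw [this]
  refine MeasurableSet.iInter fun j => measurableSet_Ioc.preimage (by fun_prop)

/-- the normalizing constant -/
def cc : ℝ≥0∞ := ENNReal.ofReal (1 / (2 * Real.pi) ^ 2)

lemma sec_mp : MeasurePreserving sec muT (cc • volume.restrict cell) := by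
  have h1 := UnitAddTorus.measurePreserving_equivPiIoc (fun _ : Fin 2 => (0:ℝ))
  have hm : MeasurableSet {x : Fin 2 → ℝ | ∀ i, x i ∈ Set.Ioc (0:ℝ) (0 + 1)} :=
    MeasurableSet.univ_pi' (fun i => measurableSet_Ioc)
  have h2 : MeasurePreserving (Subtype.val : {x : Fin 2 → ℝ // ∀ i, x i ∈ Set.Ioc (0:ℝ) (0 + 1)} → _)
      (Measure.comap Subtype.val volume) (volume.restrict {x : Fin 2 → ℝ | ∀ i, x i ∈ Set.Ioc (0:ℝ) (0 + 1)}) :=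
    ⟨measurable_subtype_coe, map_comap_subtype_coe hm volume⟩
  have hpi : (0:ℝ) < 2 * Real.pi := by positivity
  have h3 : MeasurePreserving (WithLp.toLp 2 : (Fin 2 → ℝ) → E2)
    (volume.restrict {x : Fin 2 → ℝ | ∀ i, x i ∈ Set.Ioc (0:ℝ) (0 + 1)})
    (volume.restrict {x : E2 | ∀ i, x i ∈ Set.Ioc (0:ℝ) (0 + 1)}) := by
    have := (PiLp.volume_preserving_toLp (Fin 2)).restrict_preimage
      (s := {x : E2 | ∀ i, x i ∈ Set.Ioc (0:ℝ) (0 + 1)}) (by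
        have : {x : E2 | ∀ i, x i ∈ Set.Ioc (0:ℝ) (0 + 1)} = ⋂ j : Fin 2, (fun x : E2 => x j) ⁻¹' Set.Ioc (0 : ℝ) (0 + 1) := by
          ext x; simp
        rw [this]
        exact MeasurableSet.iInter fun j => measurableSet_Ioc.preimage (by fun_prop))
    exact this
  have h4 : MeasurePreserving (fun x : E2 => (2 * Real.pi) • x)
    (volume.restrict {x : E2 | ∀ i, x i ∈ Set.Ioc (0:ℝ) (0 + 1)}) (cc • volume.restrict cell) := by
    refine ⟨by fun_prop, ?_⟩
    have hpre : {x : E2 | ∀ i, x i ∈ Set.Ioc (0:ℝ) (0 + 1)} = (fun x : E2 => (2 * Real.pi) • x) ⁻¹' cell := by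
      ext x
      simp only [cell, Set.mem_preimage, Set.mem_ofPred_eq, PiLp.smul_apply, smul_eq_mul, Set.mem_Ioc, zero_add]
      refine forall_congr' fun j => ?_
      rw [mul_pos_iff_of_pos_left hpi, mul_le_iff_le_one_right hpi]
    rw [hpre, ← Measure.restrict_map (by fun_prop) cell_meas, Measure.map_addHaar_smul _ hpi.ne',
      Measure.restrict_smul, cc]
    congr 2
    rw [abs_of_pos (by positivity)]
    simp
  exact h4.comp (h3.comp (h2.comp h1))

lemma integral_sec (g : E2 → ℂ) (hg : Continuous g) :
    ∫ θ, g (sec θ) ∂muT = (1 / (2 * Real.pi) ^ 2 : ℂ) * ∫ x in cell, g x := by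
  rw [← integral_map (μ := muT) sec_mp.aemeasurable (f := g) hg.aestronglyMeasurable, sec_mp.map_eq,
    integral_smul_measure, cc, ENNReal.toReal_ofReal (by positivity), Complex.real_smul]
  push_cast
  rfl

lemma fc_eq (f : E2 → ℂ) (hf : Continuous f) (n : Z2) :
    fourierCoeff2 f n = ∫ θ, f (sec θ) * UnitAddTorus.mFourier (-n) θ ∂muT := by
  rw [fourierCoeff2, ← integral_sec _ (by fun_prop)]
  congr 1
  ext θ
  rw [mFourier_sec]
  congr 2
  simp only [Fin.sum_univ_two, Pi.neg_apply]
  push_cast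
  ring

lemma eLp_sec (p : ℝ≥0∞) (g : E2 → ℂ) (hg : Continuous g) :
    eLpNorm (g ∘ sec) p muT = cc ^ (1 / p).toReal * eLpNorm g p (volume.restrict cell) := by
  rw [← eLpNorm_map_measure (μ := muT) hg.aestronglyMeasurable sec_mp.aemeasurable, sec_mp.map_eq,
    eLpNorm_smul_measure_of_ne_zero, smul_eq_mul]
  rw [cc]; simp

lemma eLp_le (p : ℝ≥0∞) (hp : 1 ≤ p) (g : E2 → ℂ) (hg : Continuous g) :
    eLpNorm (g ∘ sec) p muT ≤ eLpNorm g p (volume.restrict cell) := by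
  rw [eLp_sec p g hg]
  apply mul_le_of_le_one_left (zero_le)
  apply ENNReal.rpow_le_one _ ENNReal.toReal_nonneg
  rw [cc]
  apply ENNReal.ofReal_le_one.2
  rw [div_le_one (by positivity)]
  nlinarith [Real.pi_gt_three]

lemma eLp_ge (p : ℝ≥0∞) (hp : 1 ≤ p) (g : E2 → ℂ) (hg : Continuous g) :
    eLpNorm g p (volume.restrict cell) ≤ ENNReal.ofReal ((2 * Real.pi) ^ 2) * eLpNorm (g ∘ sec) p muT := by
  rw [eLp_sec p g hg, ← mul_assoc]
  apply le_mul_of_one_le_left zero_le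
  have h1 : (1 / p).toReal ≤ 1 := by
    apply ENNReal.toReal_le_of_le_ofReal zero_le_one
    simpa using hp
  have hc : cc ≤ 1 := by
    rw [cc]
    apply ENNReal.ofReal_le_one.2
    rw [div_le_one (by positivity)]
    nlinarith [Real.pi_gt_three]
  calc (1:ℝ≥0∞) = ENNReal.ofReal ((2 * Real.pi) ^ 2) * cc := by
        rw [cc, ← ENNReal.ofReal_mul (by positivity), mul_one_div_cancel (by positivity)]; simp
    _ ≤ _ := by
        gcongr
        conv_lhs => rw [← ENNReal.rpow_one cc]
        exact ENNReal.rpow_le_rpow_of_exponent_ge hc h1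

end NullForm

end

section

namespace NullForm

lemma bdd_sec (f : E2 → ℂ) (hf : Continuous f) : ∃ C, ∀ θ, ‖f (sec θ)‖ ≤ C := by
  have hK : IsCompact ((WithLp.toLp 2 : (Fin 2 → ℝ) → E2) '' (Set.Icc 0 (fun _ => 2 * Real.pi))) :=
    isCompact_Icc.image (by fun_prop)
  obtain ⟨C, hC⟩ := hK.exists_bound_of_continuousOn hf.continuousOn
  refine ⟨C, fun θ => hC _ ⟨fun j => sec θ j, ?_, rfl⟩⟩
  have h : ∀ j, sec0 θ j ∈ Set.Ioc (0:ℝ) (0 + 1) :=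
    (UnitAddTorus.measurableEquivPiIoc (fun _ : Fin 2 => (0:ℝ)) θ).2
  have hpi := Real.pi_pos
  constructor
  · intro j
    have := (h j).1
    simp only [sec_apply, Pi.zero_apply]; positivity
  · intro j
    have := (h j).2
    simp only [sec_apply]; nlinarith

lemma sec_sm (f : E2 → ℂ) (hf : Continuous f) : AEStronglyMeasurable (fun θ => f (sec θ)) muT :=
  (hf.measurable.comp sec_mp.measurable).aestronglyMeasurable

lemma conv_sum (f g : E2 → ℂ) (hf : Continuous f) (hg : Continuous g) (n : Z2) :
    HasSum (fun m => fourierCoeff2 f (n - m) * fourierCoeff2 g m)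
      (fourierCoeff2 (fun x => f x * g x) n) := by
  obtain ⟨Cf, hCf⟩ := bdd_sec f hf
  obtain ⟨Cg, hCg⟩ := bdd_sec g hg
  have hu : MemLp (fun θ => starRingEnd ℂ (f (sec θ)) * UnitAddTorus.mFourier n θ) 2 muT := by
    refine MemLp.of_bound ?_ Cf ?_
    · exact (Complex.continuous_conj.comp_aestronglyMeasurable (sec_sm f hf)).mul
        (UnitAddTorus.mFourier n).continuous.aestronglyMeasurable
    · refine Filter.Eventually.of_forall fun θ => ?_
      rw [norm_mul, RCLike.norm_conj]
      have h1 : ‖UnitAddTorus.mFourier n θ‖ ≤ 1 := by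
        have := (UnitAddTorus.mFourier n).norm_coe_le_norm θ
        rwa [UnitAddTorus.mFourier_norm] at this
      calc _ ≤ ‖f (sec θ)‖ * 1 := by gcongr
        _ ≤ Cf := by rw [mul_one]; exact hCf θ
  have hv : MemLp (fun θ => g (sec θ)) 2 muT :=
    MemLp.of_bound (sec_sm g hg) Cg (Filter.Eventually.of_forall hCg)
  have key := UnitAddTorus.hasSum_prod_mFourierCoeff (d := Fin 2) (hu.toLp _) (hv.toLp _)
  have e1 : ∀ m, (starRingEnd ℂ) (UnitAddTorus.mFourierCoeff (hu.toLp _) m) = fourierCoeff2 f (n - m) := by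
    intro m
    rw [fc_eq f hf, UnitAddTorus.mFourierCoeff, ← integral_conj]
    apply integral_congr_ae
    filter_upwards [hu.coeFn_toLp] with θ hθ
    rw [hθ]
    simp only [smul_eq_mul, map_mul, Complex.conj_conj, ← UnitAddTorus.mFourier_neg, neg_neg, neg_sub]
    rw [sub_eq_add_neg m n, UnitAddTorus.mFourier_add]
    ring
  have e2 : ∀ m, UnitAddTorus.mFourierCoeff (hv.toLp _) m = fourierCoeff2 g m := by
    intro m
    rw [fc_eq g hg, UnitAddTorus.mFourierCoeff]
    apply integral_congr_ae
    filter_upwards [hv.coeFn_toLp] with θ hθ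
    rw [hθ]
    simp only [smul_eq_mul]
    ring
  have e3 : ∫ t, (starRingEnd ℂ) (hu.toLp _ t) * hv.toLp _ t ∂muT = fourierCoeff2 (fun x => f x * g x) n := by
    rw [fc_eq _ (by fun_prop)]
    apply integral_congr_ae
    filter_upwards [hu.coeFn_toLp, hv.coeFn_toLp] with θ hθ hθ'
    rw [hθ, hθ']
    simp only [map_mul, Complex.conj_conj, ← UnitAddTorus.mFourier_neg]
    ring
  simp only [e1, e2] at key
  rw [← e3]
  exact key

lemma int_deriv_zero (g : E2 → ℂ) (hg : ContDiff ℝ 1 g) (j : Fin 2)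
    (hper : ∀ x, g (x + EuclideanSpace.single j (2 * Real.pi)) = g x) :
    ∫ x in cell, fderiv ℝ g x (EuclideanSpace.single j 1) = 0 := by
  set T : (Fin 2 → ℝ) →L[ℝ] E2 := (EuclideanSpace.equiv (Fin 2) ℝ).symm.toContinuousLinearMap with hT
  have hT' : ∀ y, T y = WithLp.toLp 2 y := fun y => rfl
  have hmp := (PiLp.volume_preserving_toLp (Fin 2))
  have hc : Continuous (fun x => fderiv ℝ g x (EuclideanSpace.single j 1)) :=
    (hg.continuous_fderiv one_ne_zero).clm_apply continuous_const
  have h1 : ∫ x in cell, fderiv ℝ g x (EuclideanSpace.single j 1)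
      = ∫ y in Set.Icc (0 : Fin 2 → ℝ) (fun _ => 2 * Real.pi), fderiv ℝ g (T y) (EuclideanSpace.single j 1) := by
    rw [← (hmp.restrict_preimage cell_meas).map_eq, integral_map hmp.measurable.aemeasurable
      hc.aestronglyMeasurable]
    have : (WithLp.toLp 2 ⁻¹' cell : Set (Fin 2 → ℝ)) = Set.pi Set.univ (fun i => Set.Ioc ((0 : Fin 2 → ℝ) i) ((fun _ => 2 * Real.pi) i)) := by
      ext y; simp [cell]
    rw [this, volume_pi, setIntegral_congr_set Measure.univ_pi_Ioc_ae_eq_Icc]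
    rfl
  have hle : (0 : Fin 2 → ℝ) ≤ (fun _ => 2 * Real.pi) := by
    intro i; have := Real.pi_pos; simp only [Pi.zero_apply]; positivity
  have hgd : ∀ x, HasFDerivAt g (fderiv ℝ g x) x := fun x =>
    (hg.differentiable one_ne_zero x).hasFDerivAt
  have hsum : ∀ y : Fin 2 → ℝ, (∑ i : Fin 2, ((if i = j then (fderiv ℝ g (T y)).comp T else 0) : (Fin 2 → ℝ) →L[ℝ] ℂ) (Pi.single i 1))
      = fderiv ℝ g (T y) (EuclideanSpace.single j 1) := by
    intro y
    rw [Finset.sum_eq_single j]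
    · simp [hT']
    · intro b _ hb; simp [hb]
    · simp
  have key := integral_divergence_of_hasFDerivAt_off_countable' (n := 1) (E := ℂ)
    (0 : Fin 2 → ℝ) (fun _ => 2 * Real.pi) hle
    (fun i y => if i = j then g (T y) else 0)
    (fun i y => if i = j then (fderiv ℝ g (T y)).comp T else 0) ∅ Set.countable_empty
    (by
      intro i
      have := hg.continuous
      by_cases hi : i = j
      · simp only [hi, if_true]; fun_prop
      · simp only [hi, if_false]; fun_prop)
    (by
      intro x _ i
      by_cases hi : i = j
      · simp only [hi, if_true]
        exact (hgd (T x)).comp x T.hasFDerivAt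
      · simp only [hi, if_false]; exact hasFDerivAt_const _ _)
    (by
      simp only [hsum]
      exact (Continuous.continuousOn (by fun_prop)).integrableOn_compact isCompact_Icc)
  simp only [hsum] at key
  rw [h1, key]
  apply Finset.sum_eq_zero
  intro i _
  by_cases hi : i = j
  · subst hi
    simp only [if_true]
    rw [sub_eq_zero]
    congr 1
    ext x
    refine Eq.trans ?_ (hper (T (i.insertNth ((0 : Fin 2 → ℝ) i) x)))
    congr 1
    ext k
    simp only [hT', PiLp.add_apply, PiLp.single_apply]
    refine Fin.succAboveCases i ?_ (fun m => ?_) k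
    · simp
    · simp [Fin.succAbove_ne]
  · simp [hi]

lemma hfin (u : E2 → ℂ) (hu : Continuous u) : IntegrableOn u cell := by
  have hb : cell ⊆ (WithLp.toLp 2 : (Fin 2 → ℝ) → E2) '' (Set.Icc 0 (fun _ => 2 * Real.pi)) := by
    intro x hx
    exact ⟨fun j => x j, ⟨fun j => (hx j).1.le, fun j => (hx j).2⟩, rfl⟩
  have hK : IsCompact ((WithLp.toLp 2 : (Fin 2 → ℝ) → E2) '' (Set.Icc 0 (fun _ => 2 * Real.pi))) :=
    isCompact_Icc.image (by fun_prop)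
  exact (hu.continuousOn.integrableOn_compact hK).mono_set hb

lemma fc_add (f g : E2 → ℂ) (hf : Continuous f) (hg : Continuous g) (n : Z2) :
    fourierCoeff2 (fun x => f x + g x) n = fourierCoeff2 f n + fourierCoeff2 g n := by
  simp only [fourierCoeff2, add_mul]
  rw [integral_add (hfin _ (by fun_prop)) (hfin _ (by fun_prop)), mul_add]

lemma fc_deriv (f : E2 → ℂ) (hf : ContDiff ℝ 1 f) (j : Fin 2)
    (hper : ∀ x, f (x + EuclideanSpace.single j (2 * Real.pi)) = f x) (n : Z2) :
    fourierCoeff2 (fun x => fderiv ℝ f x (EuclideanSpace.single j 1)) n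
      = Complex.I * (n j : ℂ) * fourierCoeff2 f n := by
  set e : E2 → ℂ := fun x => Complex.exp (-Complex.I * ((∑ j : Fin 2, (n j : ℝ) * x j : ℝ) : ℂ)) with he
  have hde : ∀ x, HasFDerivAt e (e x • (-Complex.I • Complex.ofRealCLM.comp
      (∑ j : Fin 2, (n j : ℝ) • (EuclideanSpace.proj j : E2 →L[ℝ] ℝ)))) x := by
    intro x
    have h1 : HasFDerivAt (fun x : E2 => (-Complex.I * ((∑ j : Fin 2, (n j : ℝ) * x j : ℝ) : ℂ)))
      (-Complex.I • Complex.ofRealCLM.comp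
      (∑ j : Fin 2, (n j : ℝ) • (EuclideanSpace.proj j : E2 →L[ℝ] ℝ))) x := by
      have h2 := ((-Complex.I • Complex.ofRealCLM.comp
        (∑ j : Fin 2, (n j : ℝ) • (EuclideanSpace.proj j : E2 →L[ℝ] ℝ))) : E2 →L[ℝ] ℂ).hasFDerivAt (x := x)
      convert h2 using 1
      ext x
      simp
      ring
    exact h1.cexp
  have hec : ContDiff ℝ 1 e := by
    rw [he]
    have h : ContDiff ℝ 1 (fun x : E2 => ∑ j : Fin 2, (n j : ℝ) * x j) := by fun_prop
    exact (contDiff_const.mul (Complex.ofRealCLM.contDiff.comp h)).cexp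
  have hfd : ∀ x, HasFDerivAt f (fderiv ℝ f x) x := fun x =>
    (hf.differentiable one_ne_zero x).hasFDerivAt
  have hd : ∀ x, fderiv ℝ (fun x => f x * e x) x (EuclideanSpace.single j 1) =
      fderiv ℝ f x (EuclideanSpace.single j 1) * e x - Complex.I * (n j : ℂ) * (f x * e x) := by
    intro x
    have hm : HasFDerivAt (fun x => f x * e x) _ x := (hfd x).mul (hde x)
    rw [hm.fderiv]
    simp [PiLp.single_apply]
    fin_cases j <;> simp <;> ring
  have hz := int_deriv_zero (fun x => f x * e x) (hf.mul hec) j (by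
    intro x
    simp only [hper]
    congr 1
    simp only [he]
    have : (-Complex.I * ((∑ i : Fin 2, (n i : ℝ) * (x + EuclideanSpace.single j (2 * Real.pi)) i : ℝ) : ℂ))
      = (-Complex.I * ((∑ i : Fin 2, (n i : ℝ) * x i : ℝ) : ℂ)) + ((-n j : ℤ) : ℂ) * (2 * Real.pi * Complex.I) := by
      simp only [PiLp.add_apply, mul_add, Finset.sum_add_distrib, PiLp.single_apply]
      simp
      ring
    rw [this, Complex.exp_add, Complex.exp_int_mul_two_pi_mul_I, mul_one])
  simp only [hd] at hz
  have hfc : Continuous (fun x => fderiv ℝ f x (EuclideanSpace.single j 1)) :=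
    (hf.continuous_fderiv one_ne_zero).clm_apply continuous_const
  have hfc' := hf.continuous
  have hec' := hec.continuous
  rw [integral_sub (hfin _ (by fun_prop)) (hfin _ (by fun_prop)), integral_const_mul, sub_eq_zero] at hz
  simp only [fourierCoeff2]
  change _ * ∫ x in cell, _ * e x = _ * (_ * ∫ x in cell, _ * e x)
  rw [hz]
  ring

end NullForm

end

section

namespace NullForm

variable {ρ : (Fin 2 → ℝ) → ℝ}

/-- frequency box -/
def SS (k : ℕ) : Finset Z2 :=
  Fintype.piFinset (fun _ : Fin 2 => Finset.Icc (-(2 ^ (k + 1) : ℤ)) (2 ^ (k + 1)))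

lemma mem_SS {k : ℕ} {n : Z2} (h : nn n ≤ 9 / 8 * 2 ^ k) : n ∈ SS k := by
  rw [SS, Fintype.mem_piFinset]
  intro j
  have h1 := abs_le_nn n j
  have h2 : |(n j : ℝ)| ≤ 2 ^ (k + 1) := by
    rw [pow_succ]
    have : (0:ℝ) < 2 ^ k := by positivity
    linarith
  rw [Finset.mem_Icc, ← abs_le]
  exact_mod_cast h2

/-- truncation -/
def aL (ρ : (Fin 2 → ℝ) → ℝ) (u : Z2 → ℂ) (L : ℕ) : Pol := cut (SS L) (fun n => Rk ρ L n * u n)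

lemma aL_coeff (h : Cutoff ρ) (u : Z2 → ℂ) (L : ℕ) (n : Z2) :
    (aL ρ u L).coeff n = Rk ρ L n * u n :=
  coeff_cut _ _ (fun _ hn => mem_SS (Rk_supp h (left_ne_zero_of_mul hn))) n

lemma aL_part (h : Cutoff ρ) (u : Z2 → ℂ) (L : ℕ) :
    aL ρ u L = ∑ M ∈ Finset.range (L + 2), ml (chi ρ M) (aL ρ u L) := by
  rw [← ml_sum_symb]
  simp only [sum_chi]
  rw [aL, ml_cut]
  congr 1
  funext n
  by_cases hn : Rk ρ L n = 0
  · simp [hn]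
  · have := Rk_supp h hn
    rw [Rk_one h (k := L + 1), one_mul]
    rw [pow_succ]
    have : (0:ℝ) < 2 ^ L := by positivity
    linarith

lemma aL_div (u : Fin 2 → Z2 → ℂ) (L : ℕ) (hu : ∀ n, ∑ j, Complex.I * (n j : ℂ) * u j n = 0) :
    ∑ j, Dj j (aL ρ (u j) L) = 0 := by
  simp only [Dj, aL, ml_cut]
  simp only [cut]
  rw [Finset.sum_comm]
  refine Finset.sum_eq_zero fun n _ => ?_
  have : ∑ j : Fin 2, (Complex.I * (n j : ℂ)) * (Rk ρ L n * u j n) = 0 := by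
    calc _ = Rk ρ L n * ∑ j, Complex.I * (n j : ℂ) * u j n := by
          rw [Finset.mul_sum]; refine Finset.sum_congr rfl fun j _ => ?_; ring
      _ = 0 := by rw [hu, mul_zero]
  have h2 := map_sum (AddMonoidAlgebra.lsingle (R := ℂ) (S := ℂ) n)
    (fun j : Fin 2 => (Complex.I * (n j : ℂ)) * (Rk ρ L n * u j n)) Finset.univ
  rw [this, map_zero] at h2
  exact h2.symm

lemma aL_piece (h : Cutoff ρ) (u : Z2 → ℂ) (L M : ℕ) :
    ml (chi ρ M) (aL ρ u L) = ml (Rk ρ L) (cut (SS M) (fun n => chi ρ M n * u n)) := by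
  rw [aL, ml_cut, ml_cut]
  have e : (fun n => Rk ρ L n * (chi ρ M n * u n)) = (fun n => chi ρ M n * (Rk ρ L n * u n)) := by
    funext n; ring
  rw [e]
  apply cut_congr
  · intro n hn
    exact mem_SS (Rk_supp h (left_ne_zero_of_mul (right_ne_zero_of_mul hn)))
  · intro n hn
    exact mem_SS (chi_supp h (left_ne_zero_of_mul hn))

lemma lpProj_cont (k : ℕ) (f : E2 → ℂ) : Continuous (lpProj ρ k f) := by
  unfold lpProj
  fun_prop

lemma lpProj_sec (k : ℕ) (f : E2 → ℂ) :
    lpProj ρ k f ∘ sec = ev (cut (SS k) (fun n => chi ρ k n * fourierCoeff2 f n)) := by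
  funext θ
  rw [ev_cut]
  simp only [mFourier_sec]
  rfl

lemma piece_bound (h : Cutoff ρ) : ∃ C : ℝ, 0 ≤ C ∧ ∀ (f : E2 → ℂ) (s : ℝ) (p : ℝ≥0∞), 1 ≤ p →
    ∀ L M, ((2 : ℝ≥0∞) ^ M) ^ s * nm p (ml (chi ρ M) (aL ρ (fourierCoeff2 f) L)) ≤
      ENNReal.ofReal C * besovNorm ρ s p f := by
  obtain ⟨C, hC, H⟩ := Rk_bound h
  refine ⟨C, hC, fun f s p hp L M => ?_⟩
  rw [aL_piece h]
  calc _ ≤ ((2 : ℝ≥0∞) ^ M) ^ s * (ENNReal.ofReal C * eLpNorm (lpProj ρ M f) p (volume.restrict cell)) := by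
        gcongr
        refine (H L p hp _).trans ?_
        gcongr
        rw [nm, ← lpProj_sec]
        exact eLp_le p hp _ (lpProj_cont M f)
    _ = ENNReal.ofReal C * (((2 : ℝ≥0∞) ^ M) ^ s * eLpNorm (lpProj ρ M f) p (volume.restrict cell)) := by
        ring
    _ ≤ _ := by
        gcongr
        exact le_iSup (fun k : ℕ => ((2 : ℝ≥0∞) ^ k) ^ s * eLpNorm (lpProj ρ k f) p (volume.restrict cell)) M

lemma Rk_tendsto (h : Cutoff ρ) (n : Z2) :
    Filter.Tendsto (fun L => Rk ρ L n) Filter.atTop (nhds 1) := by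
  obtain ⟨L0, hL0⟩ := pow_unbounded_of_one_lt (nn n) (one_lt_two (α := ℝ))
  refine tendsto_const_nhds.congr' ?_
  filter_upwards [Filter.eventually_ge_atTop L0] with L hL
  exact (Rk_one h (hL0.le.trans (pow_le_pow_right₀ one_le_two hL))).symm

lemma coeff_tendsto (h : Cutoff ρ) (hr : ∀ ξ, ρ ξ ∈ Set.Icc (0 : ℝ) 1) (u v : Z2 → ℂ) (j : Fin 2) (n : Z2)
    (w : ℂ) (hw : HasSum (fun m : Z2 => u (n - m) * (Complex.I * (m j : ℂ) * v m)) w) :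
    Filter.Tendsto (fun L => (aL ρ u L * Dj j (aL ρ v L)).coeff n) Filter.atTop (nhds w) := by
  have e : ∀ L, (aL ρ u L * Dj j (aL ρ v L)).coeff n =
      ∑' m, (Rk ρ L (n - m) * Rk ρ L m) * (u (n - m) * (Complex.I * (m j : ℂ) * v m)) := by
    intro L
    rw [aL, Dj, aL, ml_cut, coeff_mul_cut, tsum_eq_sum (s := SS L)]
    · refine Finset.sum_congr rfl fun m _ => ?_
      change (aL ρ u L).coeff (n - m) * _ = _
      rw [aL_coeff h]
      ring
    · intro m hm
      have : Rk ρ L m = 0 := by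
        by_contra hh
        exact hm (mem_SS (Rk_supp h hh))
      simp [this]
  simp only [e]
  rw [← hw.tsum_eq]
  have hR : ∀ L m, ‖Rk ρ L m‖ ≤ 1 := by
    intro L m
    rw [Rk, Complex.norm_real, Real.norm_eq_abs, abs_le]
    have := hr (fun j => (m j : ℝ) / 2 ^ L)
    exact ⟨by linarith [this.1], this.2⟩
  refine tendsto_tsum_of_dominated_convergence hw.summable.norm ?_ ?_
  · intro m
    have := ((Rk_tendsto h (n - m)).mul (Rk_tendsto h m)).mul_const (u (n - m) * (Complex.I * (m j : ℂ) * v m))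
    simpa using this
  · refine Filter.Eventually.of_forall fun L m => ?_
    rw [norm_mul]
    apply mul_le_of_le_one_left (norm_nonneg _)
    rw [norm_mul]
    exact mul_le_one₀ (hR _ _) (norm_nonneg _) (hR _ _)

lemma main (α α₁ α₂ : ℝ) (p p₁ p₂ : ℝ≥0∞)
    (hp : 1 ≤ p) (hp₁ : 1 ≤ p₁) (hp₂ : 1 ≤ p₂)
    (hpq : p₁⁻¹ + p₂⁻¹ ≤ p⁻¹)
    (hα : α ≤ min α₁ (α₂ - 1)) (hsum : 0 < α₁ + α₂) (hsum' : α < α₁ + α₂ - 1)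
    (h : Cutoff ρ) (hr : ∀ ξ, ρ ξ ∈ Set.Icc (0 : ℝ) 1) :
    ∃ C : ℝ, 0 < C ∧
      ∀ (A : E2 → Fin 2 → ℝ) (φ : E2 → ℂ),
        ContDiff ℝ (⊤ : ℕ∞) A → ContDiff ℝ (⊤ : ℕ∞) φ →
        (∀ (x : E2) (j k : Fin 2), A (x + EuclideanSpace.single k (2 * Real.pi)) j = A x j) →
        (∀ (x : E2) (k : Fin 2), φ (x + EuclideanSpace.single k (2 * Real.pi)) = φ x) →
        (∀ x : E2, (∑ j : Fin 2, fderiv ℝ (fun y => A y j) x (EuclideanSpace.single j 1)) = 0) →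
        besovNorm ρ α p
            (fun x => ∑ j : Fin 2, (A x j : ℂ) * fderiv ℝ φ x (EuclideanSpace.single j 1))
          ≤ ENNReal.ofReal C *
              ((⨆ j : Fin 2, besovNorm ρ α₁ p₁ (fun x => (A x j : ℂ))) *
                besovNorm ρ α₂ p₂ φ) := by
  obtain ⟨C1, hC1, H1⟩ := fin_bound h α α₁ α₂ p p₁ p₂ hp hp₂ hpq (hα.trans (min_le_left _ _))
    (hα.trans (min_le_right _ _)) hsum hsum'
  obtain ⟨C2, hC2, H2⟩ := piece_bound h
  refine ⟨(2 * Real.pi) ^ 2 * (C1 * (C2 * C2)) + 1, by positivity, ?_⟩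
  intro A φ hA hφ hAp hφp hdiv
  set XA := ⨆ j : Fin 2, besovNorm ρ α₁ p₁ (fun x => (A x j : ℂ)) with hXA
  set XB := besovNorm ρ α₂ p₂ φ with hXB
  set F : E2 → ℂ := fun x => ∑ j : Fin 2, (A x j : ℂ) * fderiv ℝ φ x (EuclideanSpace.single j 1) with hF
  set a : Fin 2 → Z2 → ℂ := fun j => fourierCoeff2 (fun x => (A x j : ℂ)) with ha
  -- regularity
  have hAj : ∀ j, ContDiff ℝ 1 (fun x => A x j) := fun j =>
    ((contDiff_pi.1 hA) j).of_le (by exact_mod_cast le_top)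
  have hAjc : ∀ j, ContDiff ℝ 1 (fun x => (A x j : ℂ)) := fun j =>
    Complex.ofRealCLM.contDiff.comp (hAj j)
  have hφ1 : ContDiff ℝ 1 φ := hφ.of_le (by exact_mod_cast le_top)
  have hφc : ∀ j, Continuous (fun x => fderiv ℝ φ x (EuclideanSpace.single j 1)) := fun j =>
    (hφ1.continuous_fderiv one_ne_zero).clm_apply continuous_const
  have hprod : ∀ j, Continuous (fun x => (A x j : ℂ) * fderiv ℝ φ x (EuclideanSpace.single j 1)) :=
    fun j => (hAjc j).continuous.mul (hφc j)
  -- divergence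
  have hdA : ∀ j x, fderiv ℝ (fun x => (A x j : ℂ)) x (EuclideanSpace.single j 1) =
      ((fderiv ℝ (fun x => A x j) x (EuclideanSpace.single j 1) : ℝ) : ℂ) := by
    intro j x
    have h1 : HasFDerivAt (fun x => A x j) (fderiv ℝ (fun x => A x j) x) x :=
      ((hAj j).differentiable one_ne_zero x).hasFDerivAt
    have h2 : HasFDerivAt (fun x => (A x j : ℂ)) _ x :=
      Complex.ofRealCLM.hasFDerivAt.comp x h1
    rw [h2.fderiv]
    rfl
  have hcdA : ∀ j, Continuous (fun x => fderiv ℝ (fun x => (A x j : ℂ)) x (EuclideanSpace.single j 1)) :=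
    fun j => ((hAjc j).continuous_fderiv one_ne_zero).clm_apply continuous_const
  have hdivc : ∀ n, ∑ j, Complex.I * (n j : ℂ) * a j n = 0 := by
    intro n
    have e : ∀ j : Fin 2, Complex.I * (n j : ℂ) * a j n = fourierCoeff2 (fun x =>
        fderiv ℝ (fun x => (A x j : ℂ)) x (EuclideanSpace.single j 1)) n := fun j =>
      (fc_deriv _ (hAjc j) j (fun x => by simp only [hAp]) n).symm
    simp only [e]
    rw [Fin.sum_univ_two, ← fc_add _ _ (hcdA 0) (hcdA 1)]
    have : (fun x => fderiv ℝ (fun x => (A x 0 : ℂ)) x (EuclideanSpace.single 0 1) +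
        fderiv ℝ (fun x => (A x 1 : ℂ)) x (EuclideanSpace.single 1 1)) = fun _ => 0 := by
      funext x
      have := hdiv x
      rw [Fin.sum_univ_two] at this
      rw [hdA, hdA, ← Complex.ofReal_add, this, Complex.ofReal_zero]
    rw [this]
    simp [fourierCoeff2]
  -- coefficients of the product
  have hconv : ∀ j n, HasSum (fun m : Z2 => a j (n - m) * (Complex.I * (m j : ℂ) * fourierCoeff2 φ m))
      (fourierCoeff2 (fun x => (A x j : ℂ) * fderiv ℝ φ x (EuclideanSpace.single j 1)) n) := by
    intro j n
    have := conv_sum (fun x => (A x j : ℂ)) _ (hAjc j).continuous (hφc j) n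
    simp only [fc_deriv φ hφ1 j (fun x => hφp x j)] at this
    exact this
  have hFc : ∀ n, fourierCoeff2 F n = ∑ j, fourierCoeff2
      (fun x => (A x j : ℂ) * fderiv ℝ φ x (EuclideanSpace.single j 1)) n := by
    intro n
    rw [Fin.sum_univ_two, ← fc_add _ _ (hprod 0) (hprod 1)]
    simp only [hF, Fin.sum_univ_two]
  refine iSup_le fun K => ?_
  set x : ℕ → Pol := fun L => ml (chi ρ K)
    (∑ j, aL ρ (a j) L * Dj j (aL ρ (fourierCoeff2 φ) L)) with hx
  have hbd : ∀ L, ((2 : ℝ≥0∞) ^ K) ^ α * nm p (x L) ≤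
      ENNReal.ofReal C1 * ((ENNReal.ofReal C2 * XA) * (ENNReal.ofReal C2 * XB)) := by
    intro L
    refine H1 _ _ (L + 2) (aL_div a L hdivc) (fun j => aL_part h _ L) (aL_part h _ L) _ _ ?_ ?_ K
    · intro j M
      refine (H2 _ α₁ p₁ hp₁ L M).trans ?_
      gcongr
      exact le_iSup (fun j : Fin 2 => besovNorm ρ α₁ p₁ (fun x => (A x j : ℂ))) j
    · intro N
      exact H2 _ α₂ p₂ hp₂ L N
  have hlim : ∀ θ, Filter.Tendsto (fun L => ev (x L) θ) Filter.atTop (nhds ((lpProj ρ K F ∘ sec) θ)) := by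
    intro θ
    rw [lpProj_sec, ev_cut]
    have e : ∀ L, ev (x L) θ = ∑ n ∈ SS K, (chi ρ K n *
        ∑ j, (aL ρ (a j) L * Dj j (aL ρ (fourierCoeff2 φ) L)).coeff n) * UnitAddTorus.mFourier n θ := by
      intro L
      rw [hx]
      simp only
      rw [ev_ml_eq (SS K) _ (fun n hn => mem_SS (chi_supp h hn))]
      refine Finset.sum_congr rfl fun n _ => ?_
      simp only [Fin.sum_univ_two, AddMonoidAlgebra.coeff_add, Finsupp.add_apply]
    simp only [e]
    refine tendsto_finsetSum _ fun n _ => Filter.Tendsto.mul_const _ (Filter.Tendsto.const_mul _ ?_)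
    rw [hFc]
    exact tendsto_finsetSum _ fun j _ => coeff_tendsto h hr _ _ j n _ (hconv j n)
  have hfat : eLpNorm (lpProj ρ K F ∘ sec) p muT ≤ Filter.liminf (fun L => nm p (x L)) Filter.atTop :=
    Lp.eLpNorm_lim_le_liminf_eLpNorm (fun L => (ev (x L)).continuous.aestronglyMeasurable) _
      (Filter.Eventually.of_forall hlim)
  set Y := ENNReal.ofReal C1 * ((ENNReal.ofReal C2 * XA) * (ENNReal.ofReal C2 * XB)) with hY
  have hw0 : ((2 : ℝ≥0∞) ^ K) ^ α ≠ 0 := by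
    rw [two_pow_rpow]; simp only [ne_eq, ENNReal.ofReal_eq_zero, not_le]; positivity
  have hwt : ((2 : ℝ≥0∞) ^ K) ^ α ≠ ⊤ := by
    rw [two_pow_rpow]; exact ENNReal.ofReal_ne_top
  have hfin2 : eLpNorm (lpProj ρ K F ∘ sec) p muT ≤ Y / ((2 : ℝ≥0∞) ^ K) ^ α := by
    refine hfat.trans ?_
    refine Filter.liminf_le_of_frequently_le' (Filter.Frequently.of_forall fun L => ?_)
    rw [ENNReal.le_div_iff_mul_le (Or.inl hw0) (Or.inl hwt), mul_comm]
    exact hbd L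
  rw [ENNReal.le_div_iff_mul_le (Or.inl hw0) (Or.inl hwt)] at hfin2
  calc _ ≤ ((2 : ℝ≥0∞) ^ K) ^ α * (ENNReal.ofReal ((2 * Real.pi) ^ 2) * eLpNorm (lpProj ρ K F ∘ sec) p muT) := by
        gcongr
        exact eLp_ge p hp _ (lpProj_cont K F)
    _ = ENNReal.ofReal ((2 * Real.pi) ^ 2) * (eLpNorm (lpProj ρ K F ∘ sec) p muT * ((2 : ℝ≥0∞) ^ K) ^ α) := by
        ring
    _ ≤ ENNReal.ofReal ((2 * Real.pi) ^ 2) * Y := by gcongr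
    _ = ENNReal.ofReal ((2 * Real.pi) ^ 2 * (C1 * (C2 * C2))) * (XA * XB) := by
        rw [hY, ENNReal.ofReal_mul (by positivity), ENNReal.ofReal_mul hC1, ENNReal.ofReal_mul hC2]
        ring
    _ ≤ _ := by
        gcongr
        linarith

end NullForm

end

end

/-- **Null-form estimate in the Coulomb gauge.** Let `α ≤ min(α₁, α₂−1)`, `α₁+α₂ > 0`,
`α₁+α₂−1 > α`, `1/p ≥ 1/p₁ + 1/p₂`, and let `ρ` be a smooth radial Littlewood–Paley
cutoff. Then there is a constant `C` (depending only on the exponents and `ρ`) such that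
for all smooth periodic `A : T² → ℝ²` with `∂_j A^j = 0` and `φ : T² → ℂ`:
`‖A^j ∂_j φ‖_{B^{α,p}} ≤ C ‖A‖_{B^{α₁,p₁}} ‖φ‖_{B^{α₂,p₂}}`. -/
theorem null_form_estimate
    (α α₁ α₂ : ℝ) (p p₁ p₂ : ℝ≥0∞)
    (hp : 1 ≤ p) (hp₁ : 1 ≤ p₁) (hp₂ : 1 ≤ p₂)
    (hpq : p₁⁻¹ + p₂⁻¹ ≤ p⁻¹)
    (hα : α ≤ min α₁ (α₂ - 1)) (hsum : 0 < α₁ + α₂) (hsum' : α < α₁ + α₂ - 1)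
    (ρ : (Fin 2 → ℝ) → ℝ)
    (hρsmooth : ContDiff ℝ (⊤ : ℕ∞) ρ)
    (hρrange : ∀ ξ, ρ ξ ∈ Set.Icc (0 : ℝ) 1)
    (hρmono : ∀ ξ η : Fin 2 → ℝ,
      Real.sqrt (∑ j : Fin 2, ξ j ^ 2) ≤ Real.sqrt (∑ j : Fin 2, η j ^ 2) → ρ η ≤ ρ ξ)
    (hρone : ∀ ξ : Fin 2 → ℝ, Real.sqrt (∑ j : Fin 2, ξ j ^ 2) ≤ 1 → ρ ξ = 1)
    (hρzero : ∀ ξ : Fin 2 → ℝ, 9 / 8 < Real.sqrt (∑ j : Fin 2, ξ j ^ 2) → ρ ξ = 0) :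
    ∃ C : ℝ, 0 < C ∧
      ∀ (A : EuclideanSpace ℝ (Fin 2) → Fin 2 → ℝ) (φ : EuclideanSpace ℝ (Fin 2) → ℂ),
        ContDiff ℝ (⊤ : ℕ∞) A → ContDiff ℝ (⊤ : ℕ∞) φ →
        (∀ (x : EuclideanSpace ℝ (Fin 2)) (j k : Fin 2),
          A (x + EuclideanSpace.single k (2 * Real.pi)) j = A x j) →
        (∀ (x : EuclideanSpace ℝ (Fin 2)) (k : Fin 2),
          φ (x + EuclideanSpace.single k (2 * Real.pi)) = φ x) →
        (∀ x : EuclideanSpace ℝ (Fin 2),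
          (∑ j : Fin 2, fderiv ℝ (fun y => A y j) x (EuclideanSpace.single j 1)) = 0) →
        besovNorm ρ α p
            (fun x => ∑ j : Fin 2, (A x j : ℂ) * fderiv ℝ φ x (EuclideanSpace.single j 1))
          ≤ ENNReal.ofReal C *
              ((⨆ j : Fin 2, besovNorm ρ α₁ p₁ (fun x => (A x j : ℂ))) *
                besovNorm ρ α₂ p₂ φ) := by
  exact NullForm.main α α₁ α₂ p p₁ p₂ hp hp₁ hp₂ hpq hα hsum hsum'
    ⟨hρsmooth, hρone, hρzero⟩ hρrange
end
end

section
/- Let I = [t₀, t₁] ⊆ R, J = I × T², and suppose φ, ψ : J → C are smooth solutions of the covariant and ordinary heat equations with the same forcing G: (∂_t − D_A^j D_{A,j}) φ = G and (∂_t − Δ) ψ = G, where A : J → R² is smooth. Then there is an absolute constant C such that ‖φ − ψ‖_{L^∞_t L²_x(J)} + ‖∇(φ − ψ)‖_{L²_{t,x}(J)} ≤ C( ‖φ(t₀) − ψ(t₀)‖_{L²_x} + ‖A φ‖_{L²_{t,x}(J)} + ‖A ψ‖_{L²_{t,x}(J)} + ‖(∂_j A^j) ψ‖_{L¹_t L²_x(J)}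 ). -/
noncomputable section
open MeasureTheory

variable {F : Type*} [NormedAddCommGroup F] [NormedSpace ℝ F]

/-- Spatial partial derivative `∂_j` on space-time `ℝ × ℝ²`. -/
def pd (j : Fin 2) (f : ℝ × EuclideanSpace ℝ (Fin 2) → F) :
    ℝ × EuclideanSpace ℝ (Fin 2) → F :=
  fun z => fderiv ℝ f z (0, EuclideanSpace.single j 1)

/-- Time derivative `∂_t` on space-time. -/
def td (f : ℝ × EuclideanSpace ℝ (Fin 2) → F) :
    ℝ × EuclideanSpace ℝ (Fin 2) → F :=
  fun z => fderiv ℝ f z (1, 0)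

/-- Spatial Laplacian `Δ = Σ_j ∂_j ∂_j` on space-time. -/
def lap2 (f : ℝ × EuclideanSpace ℝ (Fin 2) → F) :
    ℝ × EuclideanSpace ℝ (Fin 2) → F :=
  fun z => ∑ j : Fin 2, pd j (pd j f) z

/-- Spatial covariant derivative `D_{A,j} f = ∂_j f + i A_j f` on space-time. -/
def cD (A : ℝ × EuclideanSpace ℝ (Fin 2) → Fin 2 → ℝ) (j : Fin 2)
    (f : ℝ × EuclideanSpace ℝ (Fin 2) → ℂ) : ℝ × EuclideanSpace ℝ (Fin 2) → ℂ :=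
  fun z => pd j f z + Complex.I * (A z j : ℂ) * f z

/-- Covariant Laplacian `D_A^j D_{A,j}` on space-time. -/
def cLap2 (A : ℝ × EuclideanSpace ℝ (Fin 2) → Fin 2 → ℝ)
    (f : ℝ × EuclideanSpace ℝ (Fin 2) → ℂ) : ℝ × EuclideanSpace ℝ (Fin 2) → ℂ :=
  fun z => ∑ j : Fin 2, cD A j (cD A j f) z

/-- Spatial divergence `∂_j A^j` of a vector field on space-time. -/
def divx (A : ℝ × EuclideanSpace ℝ (Fin 2) → Fin 2 → ℝ)
    (z : ℝ × EuclideanSpace ℝ (Fin 2)) : ℝ :=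
  ∑ j : Fin 2, fderiv ℝ (fun w => A w j) z (0, EuclideanSpace.single j 1)

/-- Short name for the plane. -/
abbrev E2 := EuclideanSpace ℝ (Fin 2)

lemma measurableSet_cell : MeasurableSet cell := by
  have : cell = ⋂ j : Fin 2, (fun x : E2 => x j) ⁻¹' Set.Ioc (0 : ℝ) (2 * Real.pi) := by
    ext x; simp [cell]
  rw [this]
  refine MeasurableSet.iInter fun j => ?_
  have : Measurable (fun x : E2 => x j) := by fun_prop
  exact this measurableSet_Ioc

lemma cell_sub : cell ⊆ Metric.closedBall (0 : E2) (4 * Real.pi) := by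
  intro x hx
  have h0 := hx 0
  have h1 := hx 1
  have hp := Real.pi_pos
  rw [mem_closedBall_zero_iff, EuclideanSpace.norm_eq]
  apply Real.sqrt_le_iff.2 ⟨by positivity, ?_⟩
  simp only [Fin.sum_univ_two, Real.norm_eq_abs, sq_abs]
  simp only [Set.mem_Ioc] at h0 h1
  nlinarith [h0.1, h0.2, h1.1, h1.2]

lemma cell_int_on {f : E2 → ℝ} (hf : Continuous f) : IntegrableOn f cell :=
  (hf.continuousOn.integrableOn_compact (isCompact_closedBall (0 : E2) (4 * Real.pi))).mono_set
    cell_sub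

lemma cell_param {f : ℝ × E2 → ℝ} (hf : Continuous f) :
    Continuous fun t => ∫ x in cell, f (t, x) := by
  have h := continuous_parametric_integral_of_continuous
    (μ := (volume : Measure E2).restrict cell) (f := fun t x => f (t, x))
    (by exact hf) (isCompact_closedBall (0 : E2) (4 * Real.pi))
  rw [Measure.restrict_restrict Metric.isClosed_closedBall.measurableSet,
    Set.inter_eq_right.2 cell_sub] at h
  exact h

lemma cell_eq (f : E2 → ℝ) :
    ∫ x in cell, f x = ∫ p in Set.Ioc (0 : ℝ) (2 * Real.pi) ×ˢ Set.Ioc (0 : ℝ) (2 * Real.pi),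
      f !₂[p.1, p.2] := by
  let e : E2 ≃ᵐ ℝ × ℝ := (MeasurableEquiv.toLp 2 (Fin 2 → ℝ)).symm.trans MeasurableEquiv.finTwoArrow
  have he : MeasurePreserving e volume volume :=
    (volume_preserving_finTwoArrow ℝ).comp
      (EuclideanSpace.volume_preserving_symm_measurableEquiv_toLp (Fin 2))
  have h := he.setIntegral_preimage_emb e.measurableEmbedding (fun p => f !₂[p.1, p.2])
    (Set.Ioc (0 : ℝ) (2 * Real.pi) ×ˢ Set.Ioc (0 : ℝ) (2 * Real.pi))
  rw [← h]
  have hs : e ⁻¹' (Set.Ioc (0 : ℝ) (2 * Real.pi) ×ˢ Set.Ioc (0 : ℝ) (2 * Real.pi)) = cell := by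
    ext x
    simp [e, cell, MeasurableEquiv.finTwoArrow, Fin.forall_fin_two]
  rw [hs]
  congr 1
  ext x
  congr 1
  ext j
  fin_cases j <;> simp [e, MeasurableEquiv.finTwoArrow]

lemma box_int_on {f : ℝ × ℝ → ℝ} (hf : Continuous f) (a b c d : ℝ) :
    IntegrableOn f (Set.Ioc a b ×ˢ Set.Ioc c d) :=
  (hf.continuousOn.integrableOn_compact (isCompact_Icc.prod isCompact_Icc)).mono_set
    (Set.prod_mono Set.Ioc_subset_Icc_self Set.Ioc_subset_Icc_self)

lemma line_zero {f : ℝ × E2 → ℝ} (hf : ContDiff ℝ 1 f) (j : Fin 2) (t : ℝ) (γ : ℝ → E2)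
    (hγ : ∀ s, HasDerivAt γ (EuclideanSpace.single j 1) s)
    (hp : f (t, γ (2 * Real.pi)) = f (t, γ 0)) :
    ∫ s in Set.Ioc (0 : ℝ) (2 * Real.pi), pd j f (t, γ s) = 0 := by
  rw [← intervalIntegral.integral_of_le (by positivity)]
  have hγc : Continuous γ := continuous_iff_continuousAt.2 fun s => (hγ s).continuousAt
  have hc : Continuous fun s => pd j f (t, γ s) := by
    have := hf.continuous_fderiv one_ne_zero
    unfold pd
    fun_prop
  rw [intervalIntegral.integral_eq_sub_of_hasDerivAt (f := fun s => f (t, γ s))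
    (f' := fun s => pd j f (t, γ s)) _ (hc.intervalIntegrable _ _)]
  · rw [hp, sub_self]
  · intro s _
    have h1 := ((hf.differentiable one_ne_zero) (t, γ s)).hasFDerivAt
    exact h1.comp_hasDerivAt s ((hasDerivAt_const s t).prodMk (hγ s))

lemma pd_zero {f : ℝ × E2 → ℝ} (hf : ContDiff ℝ 1 f)
    (hp : ∀ (z : ℝ × E2) (k : Fin 2), f (z.1, z.2 + EuclideanSpace.single k (2 * Real.pi)) = f z)
    (j : Fin 2) (t : ℝ) : ∫ x in cell, pd j f (t, x) = 0 := by
  have hc : Continuous (pd j f) := by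
    have := hf.continuous_fderiv one_ne_zero
    unfold pd
    fun_prop
  have hv : Continuous fun p : ℝ × ℝ => (!₂[p.1, p.2] : E2) := by
    refine (PiLp.continuous_toLp 2 _).comp ?_
    refine continuous_pi fun i => ?_
    fin_cases i <;> simp <;> fun_prop
  have hcc : Continuous fun p : ℝ × ℝ => pd j f (t, !₂[p.1, p.2]) := by fun_prop
  rw [cell_eq]
  have hi := box_int_on hcc 0 (2 * Real.pi) 0 (2 * Real.pi)
  fin_cases j
  · rw [Measure.volume_eq_prod, ← Measure.prod_restrict, integral_prod_symm]
    · refine integral_eq_zero_of_ae (Filter.Eventually.of_forall fun b => ?_)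
      refine line_zero hf 0 t (fun s => !₂[s, b]) ?_ ?_
      · intro s
        have he : (fun s : ℝ => (!₂[s, b] : E2)) =
            fun s : ℝ => s • EuclideanSpace.single 0 (1 : ℝ) + !₂[0, b] := by
          ext s i; fin_cases i <;> simp
        rw [he]
        simpa using ((hasDerivAt_id s).smul_const
          (EuclideanSpace.single 0 (1 : ℝ) : E2)).add_const (!₂[0, b] : E2)
      · rw [← hp (t, !₂[0, b]) 0]
        congr 2
        ext i; fin_cases i <;> simp
    · rw [Measure.prod_restrict]; exact hi
  · rw [Measure.volume_eq_prod, ← Measure.prod_restrict, integral_prod]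
    · refine integral_eq_zero_of_ae (Filter.Eventually.of_forall fun b => ?_)
      refine line_zero hf 1 t (fun s => !₂[b, s]) ?_ ?_
      · intro s
        have he : (fun s : ℝ => (!₂[b, s] : E2)) =
            fun s : ℝ => s • EuclideanSpace.single 1 (1 : ℝ) + !₂[b, 0] := by
          ext s i; fin_cases i <;> simp
        rw [he]
        simpa using ((hasDerivAt_id s).smul_const
          (EuclideanSpace.single 1 (1 : ℝ) : E2)).add_const (!₂[b, 0] : E2)
      · rw [← hp (t, !₂[b, 0]) 1]
        congr 2
        ext i; fin_cases i <;> simp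
    · rw [Measure.prod_restrict]; exact hi

lemma td_int {f : ℝ × E2 → ℝ} (hf : ContDiff ℝ 1 f) {a b : ℝ} (hab : a ≤ b) :
    (∫ x in cell, f (b, x)) - ∫ x in cell, f (a, x)
      = ∫ s in Set.Ioc a b, ∫ x in cell, td f (s, x) := by
  have hc : Continuous (td f) := by
    have := hf.continuous_fderiv one_ne_zero
    unfold td
    fun_prop
  have hf0 := hf.continuous
  rw [integral_integral_swap]
  · rw [← integral_sub (cell_int_on (by fun_prop)) (cell_int_on (by fun_prop))]
    congr 1
    ext x
    rw [← intervalIntegral.integral_of_le hab,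
      intervalIntegral.integral_eq_sub_of_hasDerivAt (f := fun s => f (s, x))
      (f' := fun s => td f (s, x))]
    · intro s _
      have h1 := ((hf.differentiable one_ne_zero) (s, x)).hasFDerivAt
      exact h1.comp_hasDerivAt s ((hasDerivAt_id s).prodMk (hasDerivAt_const s x))
    · exact Continuous.intervalIntegrable (by fun_prop) _ _
  · rw [Measure.prod_restrict]
    exact (hc.continuousOn.integrableOn_compact
      (isCompact_Icc.prod (isCompact_closedBall (0 : E2) (4 * Real.pi)))).mono_set
      (Set.prod_mono Set.Ioc_subset_Icc_self cell_sub)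

lemma cell_cs {f g : E2 → ℝ} (hf : Continuous f) (hg : Continuous g) :
    ∫ x in cell, f x * g x ≤ √(∫ x in cell, f x ^ 2) * √(∫ x in cell, g x ^ 2) := by
  have hnf : 0 ≤ ∫ x in cell, f x ^ 2 := integral_nonneg fun x => by positivity
  rw [← Real.sqrt_mul hnf]
  apply Real.le_sqrt_of_sq_le
  have h := discrim_le_zero (a := ∫ x in cell, f x ^ 2) (b := 2 * ∫ x in cell, f x * g x)
    (c := ∫ x in cell, g x ^ 2) (fun s => by
      have h0 : 0 ≤ ∫ x in cell, (s * f x + g x) ^ 2 := integral_nonneg fun x => by positivity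
      have he : ∫ x in cell, (s * f x + g x) ^ 2 =
          (∫ x in cell, f x ^ 2) * (s * s) + (2 * ∫ x in cell, f x * g x) * s
            + ∫ x in cell, g x ^ 2 := by
        have : ∀ x, (s * f x + g x) ^ 2 = (s * s) * f x ^ 2 + (2 * s) * (f x * g x) + g x ^ 2 := by
          intro x; ring
        simp_rw [this]
        rw [integral_add, integral_add, integral_const_mul, integral_const_mul]
        · ring
        all_goals exact cell_int_on (by fun_prop)
      rw [← he]; exact h0)
  unfold discrim at h
  nlinarith

lemma alg_point (w φ ψ : ℂ) (hw : w = φ - ψ) (p : Fin 2 → ℂ) (a : Fin 2 → ℝ) (d : ℝ) :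
    2 * inner ℝ w (-(Complex.I * d * φ) - ((∑ j, a j ^ 2 : ℝ) : ℂ) * φ)
      - 2 * ∑ j, inner ℝ (p j) (p j + 2 * Complex.I * a j * φ)
    ≤ - (∑ j, ‖p j‖ ^ 2) + 4 * ((∑ j, a j ^ 2) * ‖φ‖ ^ 2) + 4 * ((∑ j, a j ^ 2) * ‖ψ‖ ^ 2)
      + 2 * (‖w‖ * (|d| * ‖ψ‖)) := by
  have h1 : inner ℝ w (-(Complex.I * d * φ)) ≤ ‖w‖ * (|d| * ‖ψ‖) := by
    have : inner ℝ w (-(Complex.I * d * φ)) = inner ℝ w (-(Complex.I * d * ψ)) := by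
      subst hw
      simp [Complex.inner]; ring
    rw [this]
    refine (real_inner_le_norm _ _).trans (le_of_eq ?_)
    simp
  have h2 : inner ℝ w (- (((∑ j, a j ^ 2 : ℝ) : ℂ) * φ)) ≤ 1 / 2 * ((∑ j, a j ^ 2) * ‖ψ‖ ^ 2) := by
    have : inner ℝ w (- (((∑ j, a j ^ 2 : ℝ) : ℂ) * φ)) =
        (∑ j, a j ^ 2) * inner ℝ w (-φ) := by
      generalize (∑ j, a j ^ 2 : ℝ) = r
      simp [Complex.inner]; ring
    rw [this]
    have hn : 0 ≤ ∑ j, a j ^ 2 := Finset.sum_nonneg fun j _ => sq_nonneg _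
    have : inner ℝ w (-φ) ≤ 1 / 2 * ‖ψ‖ ^ 2 := by
      subst hw
      simp only [Complex.inner, ← Complex.normSq_eq_norm_sq, Complex.normSq_apply]
      simp
      nlinarith [sq_nonneg (φ.re), sq_nonneg φ.im, sq_nonneg (φ.re - ψ.re), sq_nonneg (φ.im - ψ.im)]
    nlinarith
  have h3 : ∀ j, - inner ℝ (p j) (p j + 2 * Complex.I * a j * φ) ≤
      - (1 / 2) * ‖p j‖ ^ 2 + 2 * (a j ^ 2 * ‖φ‖ ^ 2) := by
    intro j
    simp only [Complex.inner, ← Complex.normSq_eq_norm_sq, Complex.normSq_apply]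
    simp
    nlinarith [sq_nonneg ((p j).re - 2 * a j * φ.im), sq_nonneg ((p j).im + 2 * a j * φ.re)]
  have h0 := h3 0
  have h4 := h3 1
  have h5 : 0 ≤ (∑ j, a j ^ 2) * ‖ψ‖ ^ 2 :=
    mul_nonneg (Finset.sum_nonneg fun j _ => sq_nonneg _) (sq_nonneg _)
  rw [sub_eq_add_neg (-(Complex.I * (d : ℂ) * φ)), inner_add_right]
  simp only [Fin.sum_univ_two] at *
  linarith

lemma pd_contDiff {f : ℝ × E2 → F} (hf : ContDiff ℝ (⊤ : ℕ∞) f) (j : Fin 2) :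
    ContDiff ℝ (⊤ : ℕ∞) (pd j f) := by
  have h : ContDiff ℝ (⊤ : ℕ∞) (fderiv ℝ f) := hf.fderiv_right (by simp)
  exact h.clm_apply contDiff_const

lemma pd_periodic {f : ℝ × E2 → F}
    (hp : ∀ (z : ℝ × E2) (k : Fin 2), f (z.1, z.2 + EuclideanSpace.single k (2 * Real.pi)) = f z)
    (j : Fin 2) (z : ℝ × E2) (k : Fin 2) :
    pd j f (z.1, z.2 + EuclideanSpace.single k (2 * Real.pi)) = pd j f z := by
  have hz : ∀ z : ℝ × E2, (z.1, z.2 + EuclideanSpace.single k (2 * Real.pi)) =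
      z + (0, EuclideanSpace.single k (2 * Real.pi)) := by
    intro z; ext <;> simp
  unfold pd
  rw [hz, ← fderiv_comp_add_right]
  congr 2
  ext w
  rw [← hz, hp]

lemma fd_mul {f : ℝ × E2 → ℂ} {a : ℝ × E2 → ℝ} {z : ℝ × E2} (hf : DifferentiableAt ℝ f z)
    (ha : DifferentiableAt ℝ a z) (c : ℂ) (v : ℝ × E2) :
    fderiv ℝ (fun z => c * (a z : ℂ) * f z) z v =
      c * (fderiv ℝ a z v : ℝ) * f z + c * (a z : ℂ) * fderiv ℝ f z v := by
  have h1 : HasFDerivAt (fun z => (a z : ℂ)) (Complex.ofRealCLM ∘L fderiv ℝ a z) z :=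
    Complex.ofRealCLM.hasFDerivAt.comp z ha.hasFDerivAt
  have h2 := (h1.const_mul c).mul hf.hasFDerivAt
  have h3 := h2.fderiv
  rw [show (fun z => c * (a z : ℂ) * f z) = (fun z => c * (a z : ℂ)) * f from rfl, h3]
  simp
  ring

lemma cD2 {A : ℝ × E2 → Fin 2 → ℝ} {f : ℝ × E2 → ℂ} (hA : ContDiff ℝ (⊤ : ℕ∞) A)
    (hf : ContDiff ℝ (⊤ : ℕ∞) f) (j : Fin 2) (z : ℝ × E2) :
    cD A j (cD A j f) z = pd j (pd j f) z
      + Complex.I * (fderiv ℝ (fun w => A w j) z (0, EuclideanSpace.single j 1) : ℝ) * f z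
      + 2 * Complex.I * (A z j : ℂ) * pd j f z - (A z j : ℂ) ^ 2 * f z := by
  have hAj : ContDiff ℝ (⊤ : ℕ∞) (fun w => A w j) := contDiff_pi.1 hA j
  have dA : DifferentiableAt ℝ (fun w => A w j) z := hAj.differentiable (by simp) z
  have df : DifferentiableAt ℝ f z := hf.differentiable (by simp) z
  have dp : DifferentiableAt ℝ (pd j f) z := (pd_contDiff hf j).differentiable (by simp) z
  have dc : DifferentiableAt ℝ (fun w => (A w j : ℂ)) z :=
    Complex.ofRealCLM.differentiableAt.comp z dA
  have h : pd j (cD A j f) z = pd j (pd j f) z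
      + (Complex.I * (fderiv ℝ (fun w => A w j) z (0, EuclideanSpace.single j 1) : ℝ) * f z
      + Complex.I * (A z j : ℂ) * pd j f z) := by
    have h2 := fd_mul df dA Complex.I (0, EuclideanSpace.single j 1)
    change fderiv ℝ (fun z => pd j f z + Complex.I * (A z j : ℂ) * f z) z _ = _
    rw [show (fun z => pd j f z + Complex.I * (A z j : ℂ) * f z) =
      pd j f + (fun z => Complex.I * (A z j : ℂ) * f z) from rfl, fderiv_add dp (by fun_prop)]
    rw [_root_.add_apply, h2]
    rfl
  conv_lhs => unfold cD
  change pd j (cD A j f) z + _ = _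
  rw [h]
  linear_combination (A z j : ℂ) ^ 2 * f z * Complex.I_sq

/-- The flux of the energy identity. -/
def flux (A : ℝ × E2 → Fin 2 → ℝ) (φ w : ℝ × E2 → ℂ) (j : Fin 2) (z : ℝ × E2) : ℝ :=
  inner ℝ (w z) (pd j w z + 2 * Complex.I * (A z j : ℂ) * φ z)

lemma cplx_contDiff {a : ℝ × E2 → ℝ} (ha : ContDiff ℝ (⊤ : ℕ∞) a) :
    ContDiff ℝ (⊤ : ℕ∞) (fun z => (a z : ℂ)) := Complex.ofRealCLM.contDiff.comp ha

lemma flux_contDiff {A : ℝ × E2 → Fin 2 → ℝ} {φ w : ℝ × E2 → ℂ} (hA : ContDiff ℝ (⊤ : ℕ∞) A)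
    (hφ : ContDiff ℝ (⊤ : ℕ∞) φ) (hw : ContDiff ℝ (⊤ : ℕ∞) w) (j : Fin 2) :
    ContDiff ℝ (⊤ : ℕ∞) (flux A φ w j) := by
  have h1 := cplx_contDiff (contDiff_pi.1 hA j)
  have h2 := pd_contDiff hw j
  have h3 : ContDiff ℝ (⊤ : ℕ∞) (fun z => pd j w z + 2 * Complex.I * (A z j : ℂ) * φ z) := by
    fun_prop
  exact hw.inner ℝ h3

lemma pd_flux {A : ℝ × E2 → Fin 2 → ℝ} {φ w : ℝ × E2 → ℂ} (hA : ContDiff ℝ (⊤ : ℕ∞) A)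
    (hφ : ContDiff ℝ (⊤ : ℕ∞) φ) (hw : ContDiff ℝ (⊤ : ℕ∞) w) (j : Fin 2) (z : ℝ × E2) :
    pd j (flux A φ w j) z =
      inner ℝ (pd j w z) (pd j w z + 2 * Complex.I * (A z j : ℂ) * φ z)
      + inner ℝ (w z) (pd j (pd j w) z +
        (2 * Complex.I * (fderiv ℝ (fun w => A w j) z (0, EuclideanSpace.single j 1) : ℝ) * φ z
        + 2 * Complex.I * (A z j : ℂ) * pd j φ z)) := by
  have hAj : ContDiff ℝ (⊤ : ℕ∞) (fun w => A w j) := contDiff_pi.1 hA j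
  have dA : DifferentiableAt ℝ (fun w => A w j) z := hAj.differentiable (by simp) z
  have df : DifferentiableAt ℝ φ z := hφ.differentiable (by simp) z
  have dw : DifferentiableAt ℝ w z := hw.differentiable (by simp) z
  have dp : DifferentiableAt ℝ (pd j w) z := (pd_contDiff hw j).differentiable (by simp) z
  have dc : DifferentiableAt ℝ (fun w => (A w j : ℂ)) z :=
    Complex.ofRealCLM.differentiableAt.comp z dA
  have h2 := fd_mul df dA (2 * Complex.I) (0, EuclideanSpace.single j 1)
  have hq : fderiv ℝ (fun z => pd j w z + 2 * Complex.I * (A z j : ℂ) * φ z) z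
      (0, EuclideanSpace.single j 1) = pd j (pd j w) z +
        (2 * Complex.I * (fderiv ℝ (fun w => A w j) z (0, EuclideanSpace.single j 1) : ℝ) * φ z
        + 2 * Complex.I * (A z j : ℂ) * pd j φ z) := by
    rw [show (fun z => pd j w z + 2 * Complex.I * (A z j : ℂ) * φ z) =
      pd j w + (fun z => 2 * Complex.I * (A z j : ℂ) * φ z) from rfl, fderiv_add dp (by fun_prop)]
    rw [_root_.add_apply, h2]
    rfl
  have := fderiv_inner_apply ℝ dw (g := fun z => pd j w z + 2 * Complex.I * (A z j : ℂ) * φ z)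
    (by fun_prop) (0, EuclideanSpace.single j 1)
  conv_lhs => unfold pd flux
  change fderiv ℝ (fun z => inner ℝ (w z) (pd j w z + 2 * Complex.I * (A z j : ℂ) * φ z)) z _ = _
  rw [this, hq, add_comm]
  rfl

lemma td_normsq {w : ℝ × E2 → ℂ} (hw : ContDiff ℝ (⊤ : ℕ∞) w) (z : ℝ × E2) :
    td (fun z => ‖w z‖ ^ 2) z = 2 * inner ℝ (w z) (td w z) := by
  have dw : DifferentiableAt ℝ w z := hw.differentiable (by simp) z
  have := dw.hasFDerivAt.norm_sq.fderiv
  unfold td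
  rw [this]
  simp
  ring

lemma point_ineq {A : ℝ × E2 → Fin 2 → ℝ} {φ ψ G : ℝ × E2 → ℂ} (hA : ContDiff ℝ (⊤ : ℕ∞) A)
    (hφ : ContDiff ℝ (⊤ : ℕ∞) φ) (hψ : ContDiff ℝ (⊤ : ℕ∞) ψ) (z : ℝ × E2)
    (h1 : td φ z = cLap2 A φ z + G z) (h2 : td ψ z = lap2 ψ z + G z) :
    td (fun z => ‖φ z - ψ z‖ ^ 2) z - 2 * ∑ j, pd j (flux A φ (fun z => φ z - ψ z) j) z
    ≤ - (∑ j, ‖pd j (fun z => φ z - ψ z) z‖ ^ 2) + 4 * ((∑ j, A z j ^ 2) * ‖φ z‖ ^ 2)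
      + 4 * ((∑ j, A z j ^ 2) * ‖ψ z‖ ^ 2)
      + 2 * (‖φ z - ψ z‖ * (|divx A z| * ‖ψ z‖)) := by
  have hw : ContDiff ℝ (⊤ : ℕ∞) (fun z => φ z - ψ z) := hφ.sub hψ
  refine le_trans (le_of_eq ?_) (alg_point (φ z - ψ z) (φ z) (ψ z) rfl
    (fun j => pd j (fun z => φ z - ψ z) z) (A z) (divx A z))
  have dsub : ∀ {f g : ℝ × E2 → ℂ}, ContDiff ℝ (⊤ : ℕ∞) f → ContDiff ℝ (⊤ : ℕ∞) g →
      ∀ z, fderiv ℝ (fun z => f z - g z) z = fderiv ℝ f z - fderiv ℝ g z := by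
    intro f g hf hg z
    exact fderiv_sub (hf.differentiable (by simp) z) (hg.differentiable (by simp) z)
  have htd : td (fun z => φ z - ψ z) z = td φ z - td ψ z := by
    unfold td; rw [dsub hφ hψ]; rfl
  have hpd : ∀ j, pd j (fun z => φ z - ψ z) = fun z => pd j φ z - pd j ψ z := by
    intro j; ext z
    unfold pd; rw [dsub hφ hψ]; rfl
  have hpd2 : ∀ j, pd j (pd j (fun z => φ z - ψ z)) z = pd j (pd j φ) z - pd j (pd j ψ) z := by
    intro j
    rw [hpd]
    conv_lhs => unfold pd
    change fderiv ℝ (fun z => pd j φ z - pd j ψ z) z _ = _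
    rw [dsub (pd_contDiff hφ j) (pd_contDiff hψ j)]; rfl
  rw [td_normsq hw, htd, h1, h2]
  simp_rw [pd_flux hA hφ hw, hpd2]
  unfold cLap2 lap2 divx
  simp_rw [cD2 hA hφ]
  simp only [Fin.sum_univ_two]
  generalize φ z - ψ z = W
  generalize pd 0 (fun z => φ z - ψ z) z = W0
  generalize pd 1 (fun z => φ z - ψ z) z = W1
  have key : ∀ (u v x y : ℂ) (c0 c1 : ℝ), u - v - x = y →
      2 * inner ℝ W u - 2 * (c0 + inner ℝ W v + (c1 + inner ℝ W x))
        = 2 * inner ℝ W y - 2 * (c0 + c1) := by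
    intro u v x y c0 c1 h
    rw [← h, inner_sub_right, inner_sub_right]
    ring
  exact key _ _ _ _ _ _ (by push_cast; ring)

lemma real_part {t₀ t₁ : ℝ} (h01 : t₀ ≤ t₁) {E g a b d e : ℝ → ℝ} (hE : Continuous E)
    (hg : Continuous g) (ha : Continuous a) (hb : Continuous b) (hd : Continuous d)
    (he : Continuous e) (hE0 : ∀ t, 0 ≤ E t) (hg0 : ∀ t, 0 ≤ g t) (ha0 : ∀ t, 0 ≤ a t)
    (hb0 : ∀ t, 0 ≤ b t)
    (hEe : ∀ t ∈ Set.Icc t₀ t₁, E t - E t₀ = ∫ s in Set.Ioc t₀ t, e s)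
    (hle : ∀ s ∈ Set.Icc t₀ t₁, e s ≤ - g s + 4 * a s + 4 * b s + 2 * (√(E s) * √(d s))) :
    (⨆ t : Set.Icc t₀ t₁, √(E t)) + √(∫ t in Set.Icc t₀ t₁, g t) ≤
      4 * (√(E t₀) + √(∫ t in Set.Icc t₀ t₁, a t) + √(∫ t in Set.Icc t₀ t₁, b t)
        + ∫ t in Set.Icc t₀ t₁, √(d t)) := by
  have int : ∀ {f : ℝ → ℝ}, Continuous f → IntegrableOn f (Set.Icc t₀ t₁) :=
    fun hf => hf.continuousOn.integrableOn_compact isCompact_Icc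
  set M := ⨆ t : Set.Icc t₀ t₁, √(E t) with hM
  have hbdd : BddAbove (Set.range fun t : Set.Icc t₀ t₁ => √(E t)) := by
    have := isCompact_range (f := fun t : Set.Icc t₀ t₁ => √(E t)) (by fun_prop)
    exact this.bddAbove
  have hMle : ∀ t ∈ Set.Icc t₀ t₁, √(E t) ≤ M := fun t ht => le_ciSup hbdd ⟨t, ht⟩
  have hM0 : 0 ≤ M := (Real.sqrt_nonneg _).trans (hMle t₀ ⟨le_rfl, h01⟩)
  set Ga := ∫ t in Set.Icc t₀ t₁, a t with hGa
  set Gb := ∫ t in Set.Icc t₀ t₁, b t with hGb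
  set D := ∫ t in Set.Icc t₀ t₁, √(d t) with hD
  have hGa0 : 0 ≤ Ga := integral_nonneg fun t => ha0 t
  have hGb0 : 0 ≤ Gb := integral_nonneg fun t => hb0 t
  have hD0 : 0 ≤ D := integral_nonneg fun t => Real.sqrt_nonneg _
  have main : ∀ t ∈ Set.Icc t₀ t₁, E t + ∫ s in Set.Ioc t₀ t, g s ≤
      E t₀ + 4 * Ga + 4 * Gb + 2 * M * D := by
    intro t ht
    have hsub : Set.Ioc t₀ t ⊆ Set.Icc t₀ t₁ :=
      Set.Ioc_subset_Icc_self.trans (Set.Icc_subset_Icc_right ht.2)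
    have hS : Continuous fun s => √(d s) := by fun_prop
    have int' : ∀ {f : ℝ → ℝ}, Continuous f → IntegrableOn f (Set.Ioc t₀ t) :=
      fun hf => (int hf).mono_set hsub
    have h1 : ∫ s in Set.Ioc t₀ t, e s ≤
        ∫ s in Set.Ioc t₀ t, (- g s + 4 * a s + 4 * b s + 2 * M * √(d s)) := by
      refine setIntegral_mono_on (int' he) (int' (by fun_prop)) measurableSet_Ioc ?_
      intro s hs
      have h2 := mul_le_mul_of_nonneg_right (hMle s (hsub hs)) (Real.sqrt_nonneg (d s))
      have h3 := hle s (hsub hs)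
      linarith
    have h2 : ∫ s in Set.Ioc t₀ t, (- g s + 4 * a s + 4 * b s + 2 * M * √(d s)) =
        - (∫ s in Set.Ioc t₀ t, g s) + 4 * (∫ s in Set.Ioc t₀ t, a s)
          + 4 * (∫ s in Set.Ioc t₀ t, b s) + 2 * M * ∫ s in Set.Ioc t₀ t, √(d s) := by
      rw [integral_add, integral_add, integral_add, integral_neg, integral_const_mul,
        integral_const_mul, integral_const_mul]
      all_goals exact int' (by fun_prop)
    have mono : ∀ {f : ℝ → ℝ}, Continuous f → (∀ t, 0 ≤ f t) →
        ∫ s in Set.Ioc t₀ t, f s ≤ ∫ s in Set.Icc t₀ t₁, f s := by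
      intro f hf hf0
      exact setIntegral_mono_set (int hf) (Filter.Eventually.of_forall hf0)
        hsub.eventuallyLE
    have h3 := mono ha ha0
    have h4 := mono hb hb0
    have h5 := mul_le_mul_of_nonneg_left (mono hS fun t => Real.sqrt_nonneg _)
      (by positivity : 0 ≤ 2 * M)
    have h6 := hEe t ht
    linarith
  set Q := E t₀ + 4 * Ga + 4 * Gb + 2 * M * D with hQ
  have hMQ : M ≤ √Q := by
    have : Nonempty (Set.Icc t₀ t₁) := ⟨⟨t₀, le_rfl, h01⟩⟩
    refine ciSup_le fun t => Real.sqrt_le_sqrt ?_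
    have h1 := main t t.2
    have h2 : 0 ≤ ∫ s in Set.Ioc t₀ (t : ℝ), g s := integral_nonneg fun t => hg0 t
    linarith
  have hgQ : ∫ t in Set.Icc t₀ t₁, g t ≤ Q := by
    have h1 := main t₁ ⟨h01, le_rfl⟩
    rw [integral_Icc_eq_integral_Ioc]
    linarith [hE0 t₁]
  have hQ0 : 0 ≤ Q := by have := hE0 t₀; positivity
  have hQs := Real.sq_sqrt hQ0
  have e1 := Real.sq_sqrt (hE0 t₀)
  have e2 := Real.sq_sqrt hGa0
  have e3 := Real.sq_sqrt hGb0
  have n0 := Real.sqrt_nonneg Q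
  have n1 := Real.sqrt_nonneg (E t₀)
  have n2 := Real.sqrt_nonneg Ga
  have n3 := Real.sqrt_nonneg Gb
  set q := √Q
  set u := √(E t₀)
  set v := √Ga
  set y := √Gb
  have hq : q ≤ u + 2 * v + 2 * y + 2 * D := by
    have h1 : q ^ 2 ≤ (u + 2 * v + 2 * y) ^ 2 + 2 * q * D := by
      have := mul_le_mul_of_nonneg_right hMQ hD0
      nlinarith [mul_nonneg n1 n2, mul_nonneg n1 n3, mul_nonneg n2 n3]
    by_contra hc
    push Not at hc
    have : 0 ≤ u + 2 * v + 2 * y := by positivity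
    nlinarith
  have hgs : √(∫ t in Set.Icc t₀ t₁, g t) ≤ q := Real.sqrt_le_sqrt hgQ
  linarith

/-- **Difference between the covariant and the ordinary heat flow.** If `φ` and `ψ` solve
`(∂_t − D_A^j D_{A,j}) φ = G` and `(∂_t − Δ) ψ = G` on `J = [t₀,t₁] × T²`, then with an
absolute constant `C`:
`‖φ−ψ‖_{L^∞_t L²_x(J)} + ‖∇(φ−ψ)‖_{L²_{t,x}(J)}
  ≤ C(‖φ(t₀)−ψ(t₀)‖_{L²_x} + ‖Aφ‖_{L²_{t,x}(J)} + ‖Aψ‖_{L²_{t,x}(J)} + ‖(∂_j A^j)ψ‖_{L¹_t L²_x(J)})`. -/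
theorem covariant_vs_euclidean_heat_difference :
    ∃ C : ℝ, 0 < C ∧
      ∀ (t₀ t₁ : ℝ), t₀ ≤ t₁ →
      ∀ (A : ℝ × EuclideanSpace ℝ (Fin 2) → Fin 2 → ℝ)
        (φ ψ G : ℝ × EuclideanSpace ℝ (Fin 2) → ℂ),
        ContDiff ℝ (⊤ : ℕ∞) A → ContDiff ℝ (⊤ : ℕ∞) φ →
        ContDiff ℝ (⊤ : ℕ∞) ψ → ContDiff ℝ (⊤ : ℕ∞) G →
        (∀ (z : ℝ × EuclideanSpace ℝ (Fin 2)) (j k : Fin 2),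
          A (z.1, z.2 + EuclideanSpace.single k (2 * Real.pi)) j = A z j) →
        (∀ (z : ℝ × EuclideanSpace ℝ (Fin 2)) (k : Fin 2),
          φ (z.1, z.2 + EuclideanSpace.single k (2 * Real.pi)) = φ z) →
        (∀ (z : ℝ × EuclideanSpace ℝ (Fin 2)) (k : Fin 2),
          ψ (z.1, z.2 + EuclideanSpace.single k (2 * Real.pi)) = ψ z) →
        (∀ (z : ℝ × EuclideanSpace ℝ (Fin 2)) (k : Fin 2),
          G (z.1, z.2 + EuclideanSpace.single k (2 * Real.pi)) = G z) →
        (∀ z : ℝ × EuclideanSpace ℝ (Fin 2), z.1 ∈ Set.Icc t₀ t₁ →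
          td φ z = cLap2 A φ z + G z) →
        (∀ z : ℝ × EuclideanSpace ℝ (Fin 2), z.1 ∈ Set.Icc t₀ t₁ →
          td ψ z = lap2 ψ z + G z) →
        (⨆ t : Set.Icc t₀ t₁,
            Real.sqrt (∫ x in cell, ‖φ ((t : ℝ), x) - ψ ((t : ℝ), x)‖ ^ 2))
          + Real.sqrt (∫ t in Set.Icc t₀ t₁, ∫ x in cell,
              ∑ j : Fin 2, ‖pd j (fun w => φ w - ψ w) (t, x)‖ ^ 2)
        ≤ C * (Real.sqrt (∫ x in cell, ‖φ (t₀, x) - ψ (t₀, x)‖ ^ 2)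
            + Real.sqrt (∫ t in Set.Icc t₀ t₁, ∫ x in cell,
                (∑ j : Fin 2, (A (t, x) j) ^ 2) * ‖φ (t, x)‖ ^ 2)
            + Real.sqrt (∫ t in Set.Icc t₀ t₁, ∫ x in cell,
                (∑ j : Fin 2, (A (t, x) j) ^ 2) * ‖ψ (t, x)‖ ^ 2)
            + ∫ t in Set.Icc t₀ t₁,
                Real.sqrt (∫ x in cell, (divx A (t, x)) ^ 2 * ‖ψ (t, x)‖ ^ 2)) := by
  refine ⟨4, by norm_num, ?_⟩
  intro t₀ t₁ h01 A φ ψ G hA hφ hψ _ pA pφ pψ _ e1 e2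
  have hw : ContDiff ℝ (⊤ : ℕ∞) (fun z => φ z - ψ z) := hφ.sub hψ
  have hn : ContDiff ℝ (⊤ : ℕ∞) (fun z => ‖φ z - ψ z‖ ^ 2) := hw.norm_sq ℝ
  have hn1 : ContDiff ℝ 1 (fun z => ‖φ z - ψ z‖ ^ 2) := hn.of_le (by exact_mod_cast le_top)
  have cφ := hφ.continuous
  have cψ := hψ.continuous
  have cA : ∀ j, Continuous fun z => A z j := fun j => (contDiff_pi.1 hA j).continuous
  have cp : ∀ j, Continuous (pd j fun z => φ z - ψ z) := fun j => (pd_contDiff hw j).continuous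
  have cdiv : Continuous (divx A) := by
    refine continuous_finsetSum _ fun j _ => ?_
    exact (pd_contDiff (contDiff_pi.1 hA j) j).continuous
  have cg : Continuous fun z => ∑ j : Fin 2, ‖pd j (fun z => φ z - ψ z) z‖ ^ 2 := by fun_prop
  have ca : Continuous fun z => (∑ j : Fin 2, (A z j) ^ 2) * ‖φ z‖ ^ 2 := by fun_prop
  have cb : Continuous fun z => (∑ j : Fin 2, (A z j) ^ 2) * ‖ψ z‖ ^ 2 := by fun_prop
  have cd : Continuous fun z => (divx A z) ^ 2 * ‖ψ z‖ ^ 2 := by fun_prop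
  have ce : Continuous (td fun z => ‖φ z - ψ z‖ ^ 2) := by
    have := hn1.continuous_fderiv one_ne_zero
    unfold td
    fun_prop
  have hfl : ∀ j, ContDiff ℝ 1 (flux A φ (fun z => φ z - ψ z) j) := fun j =>
    (flux_contDiff hA hφ hw j).of_le (by exact_mod_cast le_top)
  have cfl : ∀ j, Continuous (pd j (flux A φ (fun z => φ z - ψ z) j)) := fun j =>
    (pd_contDiff (flux_contDiff hA hφ hw j) j).continuous
  have pw : ∀ (z : ℝ × E2) (k : Fin 2),
      (fun z => φ z - ψ z) (z.1, z.2 + EuclideanSpace.single k (2 * Real.pi))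
        = (fun z => φ z - ψ z) z := by
    intro z k
    simp only [pφ, pψ]
  have pfl : ∀ j (z : ℝ × E2) (k : Fin 2),
      flux A φ (fun z => φ z - ψ z) j (z.1, z.2 + EuclideanSpace.single k (2 * Real.pi))
        = flux A φ (fun z => φ z - ψ z) j z := by
    intro j z k
    unfold flux
    rw [pd_periodic pw]
    simp only [pφ, pψ, pA]
  refine real_part h01 (E := fun t => ∫ x in cell, ‖φ (t, x) - ψ (t, x)‖ ^ 2)
    (e := fun t => ∫ x in cell, td (fun z => ‖φ z - ψ z‖ ^ 2) (t, x))
    (cell_param hn.continuous) (cell_param cg) (cell_param ca) (cell_param cb) (cell_param cd)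
    (cell_param ce) (fun t => integral_nonneg fun x => by positivity)
    (fun t => integral_nonneg fun x => by positivity)
    (fun t => integral_nonneg fun x => by positivity)
    (fun t => integral_nonneg fun x => by positivity)
    (fun t ht => td_int hn1 ht.1) ?_
  intro s hs
  have hz : ∫ x in cell, 2 * ∑ j, pd j (flux A φ (fun z => φ z - ψ z) j) (s, x) = 0 := by
    rw [integral_const_mul]
    simp only [Fin.sum_univ_two]
    rw [integral_add (cell_int_on (by fun_prop))
      (cell_int_on (by fun_prop)), pd_zero (hfl 0) (pfl 0), pd_zero (hfl 1) (pfl 1)]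
    norm_num
  have hcs := cell_cs (f := fun x => ‖φ (s, x) - ψ (s, x)‖)
    (g := fun x => |divx A (s, x)| * ‖ψ (s, x)‖) (by fun_prop) (by fun_prop)
  simp only [mul_pow, sq_abs] at hcs
  have hm : ∫ x in cell, (td (fun z => ‖φ z - ψ z‖ ^ 2) (s, x)
        - 2 * ∑ j, pd j (flux A φ (fun z => φ z - ψ z) j) (s, x)) ≤
      ∫ x in cell, (- (∑ j, ‖pd j (fun z => φ z - ψ z) (s, x)‖ ^ 2)
        + 4 * ((∑ j, A (s, x) j ^ 2) * ‖φ (s, x)‖ ^ 2)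
        + 4 * ((∑ j, A (s, x) j ^ 2) * ‖ψ (s, x)‖ ^ 2)
        + 2 * (‖φ (s, x) - ψ (s, x)‖ * (|divx A (s, x)| * ‖ψ (s, x)‖))) := by
    refine integral_mono (cell_int_on (by fun_prop)) (cell_int_on (by fun_prop)) ?_
    intro x
    exact point_ineq (G := G) hA hφ hψ (s, x) (e1 (s, x) hs) (e2 (s, x) hs)
  rw [integral_sub (cell_int_on (by fun_prop)) (cell_int_on (by fun_prop)), hz, sub_zero,
    integral_add (cell_int_on (by fun_prop)) (cell_int_on (by fun_prop)),
    integral_add (cell_int_on (by fun_prop)) (cell_int_on (by fun_prop)),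
    integral_add (cell_int_on (by fun_prop)) (cell_int_on (by fun_prop)),
    integral_neg, integral_const_mul, integral_const_mul, integral_const_mul] at hm
  refine hm.trans ?_
  linarith
end
end
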